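/- arXiv:1911.03924 — 2 statements merged into one kernel-verified Lean document; each statement's English description precedes it below -/
import Mathlib

section
/- Let n ≥ 1, m ∈ ℝ, 0 ≤ δ ≤ 1 and 0 < ρ ≤ 1. A function a : ℝⁿ × ℤⁿ → ℂ such that x ↦ a(x,ξ) is smooth and 1-periodic for each ξ ∈ ℤⁿ belongs to the toroidal symbol class S^m_{ρ,δ}(𝕋ⁿ × ℤⁿ) if and only if there exists a function a' : ℝⁿ × ℝⁿ → ℂ in the Euclidean symbol class S^m_{ρ,δ}(𝕋ⁿ × ℝⁿ) such that a'(x, ξ) = a(x, ξ) for every x ∈ ℝⁿ and every ξ ∈ ℤⁿ. -/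
open scoped BigOperators

/-- Directional derivative in the `j`-th coordinate direction. -/
noncomputable def dline {n : ℕ} (j : Fin n) (f : (Fin n → ℝ) → ℂ) : (Fin n → ℝ) → ℂ :=
  fun x => fderiv ℝ f x (fun i => if i = j then (1 : ℝ) else 0)

/-- Multi-index partial derivative `∂^β`. -/
noncomputable def mderiv {n : ℕ} (β : Fin n → ℕ) (f : (Fin n → ℝ) → ℂ) : (Fin n → ℝ) → ℂ :=
  (List.finRange n).foldr (fun j g => (dline j)^[β j] g) f

/-- Forward difference in the `j`-th coordinate direction. -/
def fdiff {n : ℕ} (j : Fin n) (f : (Fin n → ℤ) → ℂ) : (Fin n → ℤ) → ℂ :=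
  fun ξ => f (ξ + fun i => if i = j then 1 else 0) - f ξ

/-- Multi-index forward difference `Δ^α`. -/
def mdiff {n : ℕ} (α : Fin n → ℕ) (f : (Fin n → ℤ) → ℂ) : (Fin n → ℤ) → ℂ :=
  (List.finRange n).foldr (fun j g => (fdiff j)^[α j] g) f

/-- The Euclidean symbol class `S^m_{ρ,δ}(𝕋ⁿ × ℝⁿ)`: smooth functions, `1`-periodic in the
first variable, satisfying the Hörmander estimates
`|∂_x^β ∂_ξ^α a'(x,ξ)| ≤ C (1+|ξ|²)^{(m-ρ|α|+δ|β|)/2}`. -/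
def EuclideanSymbolClass (n : ℕ) (m ρ δ : ℝ) (a' : (Fin n → ℝ) → (Fin n → ℝ) → ℂ) : Prop :=
  ContDiff ℝ (⊤ : ℕ∞) (fun p : (Fin n → ℝ) × (Fin n → ℝ) => a' p.1 p.2) ∧
  (∀ (x ξ : Fin n → ℝ) (k : Fin n → ℤ), a' (x + fun i => (k i : ℝ)) ξ = a' x ξ) ∧
  ∀ α β : Fin n → ℕ, ∃ C : ℝ, 0 < C ∧ ∀ x ξ : Fin n → ℝ,
    ‖mderiv β (fun y => mderiv α (fun η => a' y η) ξ) x‖ ≤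
      C * (1 + ∑ i, ξ i ^ 2) ^ ((m - ρ * ∑ i, (α i : ℝ) + δ * ∑ i, (β i : ℝ)) / 2)

/-- The toroidal symbol class `S^m_{ρ,δ}(𝕋ⁿ × ℤⁿ)`: functions smooth and `1`-periodic in the
first variable satisfying `|Δ_ξ^α ∂_x^β a(x,ξ)| ≤ C (1+|ξ|²)^{(m-ρ|α|+δ|β|)/2}`. -/
def ToroidalSymbolClass (n : ℕ) (m ρ δ : ℝ) (a : (Fin n → ℝ) → (Fin n → ℤ) → ℂ) : Prop :=
  ∀ α β : Fin n → ℕ, ∃ C : ℝ, 0 < C ∧ ∀ (x : Fin n → ℝ) (ξ : Fin n → ℤ),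
    ‖mdiff α (fun η => mderiv β (fun y => a y η) x) ξ‖ ≤
      C * (1 + ∑ i, (ξ i : ℝ) ^ 2) ^ ((m - ρ * ∑ i, (α i : ℝ) + δ * ∑ i, (β i : ℝ)) / 2)


namespace TS
open MeasureTheory Complex FourierTransform SchwartzMap

noncomputable def sT (x : ℝ) : ℝ := Real.smoothTransition (2 * x - 1/2)

lemma sT_contDiff : ContDiff ℝ (⊤:ℕ∞) sT := by
  unfold sT
  exact Real.smoothTransition.contDiff.comp (by fun_prop)

lemma sT_zero {x : ℝ} (h : x ≤ 1/4) : sT x = 0 :=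
  Real.smoothTransition.zero_of_nonpos (by linarith)
lemma sT_one {x : ℝ} (h : 3/4 ≤ x) : sT x = 1 :=
  Real.smoothTransition.one_of_one_le (by linarith)

noncomputable def theta (x : ℝ) : ℂ := ((sT (x + 1) - sT x : ℝ) : ℂ)

lemma theta_contDiff : ContDiff ℝ (⊤:ℕ∞) theta := by
  unfold theta
  have h1 : ContDiff ℝ (⊤:ℕ∞) (fun x : ℝ => sT (x+1)) := sT_contDiff.comp (by fun_prop)
  exact Complex.ofRealCLM.contDiff.comp (h1.sub sT_contDiff)

lemma theta_zero {x : ℝ} (h : 3/4 ≤ |x|) : theta x = 0 := by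
  unfold theta
  rcases le_abs.1 h with h | h
  · rw [sT_one h, sT_one (by linarith)]; simp
  · rw [sT_zero (by linarith), sT_zero (by linarith)]; simp

noncomputable def hS (x : ℝ) : ℂ := dslope Complex.exp 0 (-(2 * Real.pi * I) * x)

lemma hS_contDiff : ContDiff ℝ (⊤:ℕ∞) hS := by
  have h1 : Differentiable ℂ (dslope Complex.exp 0) := by
    rw [← differentiableOn_univ, Complex.differentiableOn_dslope Filter.univ_mem]
    exact Complex.differentiable_exp.differentiableOn
  have h2 : ContDiff ℝ (⊤:ℕ∞) (dslope Complex.exp 0) := (h1.contDiff).restrict_scalars ℝ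
  unfold hS
  refine h2.comp ?_
  exact contDiff_const.mul Complex.ofRealCLM.contDiff

lemma hS_mul (x : ℝ) : -(2 * Real.pi * I) * x * hS x = Complex.exp (-(2 * Real.pi * I) * x) - 1 := by
  have := sub_smul_dslope Complex.exp 0 (-(2 * Real.pi * I) * x)
  simpa [hS] using this

lemma hS_ne {x : ℝ} (h : |x| < 1) : hS x ≠ 0 := by
  intro h0
  by_cases hx : x = 0
  · subst hx
    simp [hS] at h0
  have h1 := hS_mul x
  rw [h0, mul_zero] at h1
  have h2 : Complex.exp (-(2 * Real.pi * I) * x) = 1 := by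
    linear_combination -h1
  obtain ⟨k, hk⟩ := Complex.exp_eq_one_iff.1 h2
  have h3 : (x:ℂ) = ((-k : ℤ):ℂ) := by
    have : (2 * Real.pi * I : ℂ) ≠ 0 := Complex.two_pi_I_ne_zero
    apply mul_left_cancel₀ this
    push_cast
    linear_combination -hk
  have h4 : x = ((-k : ℤ) : ℝ) := by exact_mod_cast h3
  rw [h4] at h hx
  have h5 : |(-k : ℤ)| < 1 := by exact_mod_cast h
  rw [Int.abs_lt_one_iff] at h5
  apply hx
  rw [h5]; simp

noncomputable def fK (k : ℕ) (x : ℝ) : ℂ := theta x / hS x ^ k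

lemma fK_zero (k : ℕ) {x : ℝ} (h : 3/4 ≤ |x|) : fK k x = 0 := by
  simp [fK, theta_zero h]

lemma fK_contDiff (k : ℕ) : ContDiff ℝ (⊤:ℕ∞) (fK k) := by
  rw [contDiff_iff_contDiffAt]
  intro x
  by_cases h : |x| < 1
  · have h1 : ContDiffAt ℝ (⊤:ℕ∞) (fun y => (hS y ^ k)⁻¹) x :=
      (hS_contDiff.contDiffAt.pow k).inv (pow_ne_zero _ (hS_ne h))
    have h2 := theta_contDiff.contDiffAt.mul h1 (x := x)
    have h3 : fK k = fun y => theta y * (hS y ^ k)⁻¹ := by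
      ext y; rw [fK, div_eq_mul_inv]
    rw [h3]; exact h2
  · have : fK k =ᶠ[nhds x] fun _ => 0 := by
      have h2 : {y : ℝ | 3/4 < |y|} ∈ nhds x :=
        (isOpen_lt continuous_const continuous_abs).mem_nhds (by simp; linarith)
      filter_upwards [h2] with y hy using fK_zero k (le_of_lt hy)
    exact contDiffAt_const.congr_of_eventuallyEq this

lemma fK_compact (k : ℕ) : HasCompactSupport (fK k) := by
  apply HasCompactSupport.intro (isCompact_Icc (a := (-1:ℝ)) (b := 1))
  intro x hx
  apply fK_zero
  by_contra h
  push Not at h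
  apply hx
  have := abs_lt.1 h
  constructor <;> linarith [this.1, this.2]

noncomputable def fS (k : ℕ) : 𝓢(ℝ, ℂ) := (fK_compact k).toSchwartzMap (fK_contDiff k)

lemma fS_apply (k : ℕ) (x : ℝ) : fS k x = fK k x := rfl

noncomputable def phiS (k : ℕ) : 𝓢(ℝ, ℂ) := 𝓕 (fS k)

lemma phiS_eq (k : ℕ) (t : ℝ) : phiS k t = ∫ v : ℝ, Complex.exp (↑(-2 * Real.pi * v * t) * I) * fK k v := by
  have : phiS k t = 𝓕 (fS k : ℝ → ℂ) t := by
    unfold phiS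
    rw [← SchwartzMap.fourier_coe]
  rw [this, Real.fourier_real_eq_integral_exp_smul]
  rfl

lemma fK_succ (k : ℕ) (x : ℝ) :
    (Complex.exp (-(2 * Real.pi * I) * x) - 1) * fK (k+1) x = -(2 * Real.pi * I) * x * fK k x := by
  by_cases h : |x| < 1
  · rw [← hS_mul]
    have := hS_ne h
    unfold fK
    field_simp
    ring
  · rw [fK_zero, fK_zero]; simp
    all_goals linarith

lemma fK_integrable (k : ℕ) (t : ℝ) :
    Integrable (fun v : ℝ => Complex.exp (↑(-2 * Real.pi * v * t) * I) * fK k v) := by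
  apply Continuous.integrable_of_hasCompactSupport
  · have := (fK_contDiff k).continuous
    fun_prop
  · exact (fK_compact k).mul_left

lemma phiS_deriv (k : ℕ) (t : ℝ) :
    HasDerivAt (phiS k) (phiS (k+1) (t+1) - phiS (k+1) t) t := by
  have h1 : HasDerivAt (𝓕 (fS k : ℝ → ℂ)) (𝓕 (fun x : ℝ ↦ (-2 * Real.pi * I * x) • fS k x) t) t := by
    apply Real.hasDerivAt_fourier
    · exact (fS k).integrable
    · have h := (fK_contDiff k).continuous
      apply Continuous.integrable_of_hasCompactSupport
      · exact (Complex.continuous_ofReal.comp continuous_id |>.smul h) 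
      · exact (fK_compact k).mul_left
  have h2 : (phiS k : ℝ → ℂ) = 𝓕 (fS k : ℝ → ℂ) := by
    unfold phiS
    rw [← SchwartzMap.fourier_coe]
  rw [h2]
  convert h1 using 1
  rw [phiS_eq, phiS_eq, ← integral_sub (fK_integrable _ _) (fK_integrable _ _),
    Real.fourier_real_eq_integral_exp_smul]
  congr 1
  ext v
  have := fK_succ k v
  rw [fS_apply, smul_eq_mul, smul_eq_mul]
  have e : Complex.exp (↑(-2 * Real.pi * v * (t+1)) * I)
    = Complex.exp (↑(-2 * Real.pi * v * t) * I) * Complex.exp (-(2 * Real.pi * I) * v) := by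
    rw [← Complex.exp_add]; congr 1; push_cast; ring
  rw [e]
  linear_combination Complex.exp (↑(-2 * Real.pi * v * t) * I) * this

lemma phiS_int (z : ℤ) : phiS 0 z = if z = 0 then 1 else 0 := by
  rw [phiS_eq]
  have hc : Continuous (fun v : ℝ => Complex.exp (↑(-2 * Real.pi * v * z) * I)) := by fun_prop
  have hs : Continuous (fun v : ℝ => (sT v : ℂ)) :=
    Complex.continuous_ofReal.comp sT_contDiff.continuous
  have hs1 : Continuous (fun v : ℝ => (sT (v+1) : ℂ)) := hs.comp (continuous_id.add continuous_const)
  have h0 : (∫ v : ℝ, Complex.exp (↑(-2 * Real.pi * v * z) * I) * fK 0 v)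
      = ∫ v in (-1:ℝ)..1, Complex.exp (↑(-2 * Real.pi * v * z) * I) * fK 0 v := by
    rw [intervalIntegral.integral_eq_integral_of_support_subset]
    intro v hv
    by_contra hn
    apply hv
    simp only
    rw [fK_zero, mul_zero]
    by_contra h
    push Not at h
    have := abs_lt.1 h
    apply hn
    constructor <;> linarith [this.1, this.2]
  have hfc : Continuous (fun v : ℝ => Complex.exp (↑(-2 * Real.pi * v * z) * I) * fK 0 v) :=
    hc.mul (fK_contDiff 0).continuous
  rw [h0, ← intervalIntegral.integral_add_adjacent_intervals (b := 0)
    (hfc.intervalIntegrable _ _) (hfc.intervalIntegrable _ _)]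
  have h1 : (∫ v in (-1:ℝ)..0, Complex.exp (↑(-2 * Real.pi * v * z) * I) * fK 0 v)
      = ∫ v in (0:ℝ)..1, Complex.exp (↑(-2 * Real.pi * v * z) * I) * sT v := by
    have := intervalIntegral.integral_comp_sub_right (a := 0) (b := 1)
      (fun v : ℝ => Complex.exp (↑(-2 * Real.pi * v * z) * I) * fK 0 v) 1
    norm_num at this
    norm_num
    rw [← this]
    apply intervalIntegral.integral_congr
    intro v hv
    rw [Set.uIcc_of_le zero_le_one] at hv
    simp only [fK, theta, pow_zero, div_one, sub_add_cancel]
    rw [sT_zero (x := v - 1) (by linarith [hv.2]), sub_zero]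
    congr 1
    rw [Complex.exp_eq_exp_iff_exists_int]
    refine ⟨z, ?_⟩
    push_cast
    ring
  have h2 : (∫ v in (0:ℝ)..1, Complex.exp (↑(-2 * Real.pi * v * z) * I) * fK 0 v)
      = ∫ v in (0:ℝ)..1, Complex.exp (↑(-2 * Real.pi * v * z) * I) * (1 - sT v) := by
    apply intervalIntegral.integral_congr
    intro v hv
    rw [Set.uIcc_of_le zero_le_one] at hv
    simp only [fK, theta, pow_zero, div_one]
    rw [sT_one (x := v + 1) (by linarith [hv.1])]
    simp
  rw [h1, h2, ← intervalIntegral.integral_add]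
  rotate_left
  · exact (hc.mul hs).intervalIntegrable _ _
  · exact (hc.mul (continuous_const.sub hs)).intervalIntegrable _ _
  have h3 : ∀ v : ℝ, Complex.exp (↑(-2 * Real.pi * v * z) * I) * sT v +
    Complex.exp (↑(-2 * Real.pi * v * z) * I) * (1 - sT v) =
      Complex.exp ((-2 * Real.pi * z * I) * v) := by
    intro v
    rw [← mul_add, add_sub_cancel, mul_one]
    congr 1
    push_cast; ring
  simp_rw [h3]
  split_ifs with hz
  · simp [hz]
  · have hne : (-2 * Real.pi * z * I : ℂ) ≠ 0 := by
      have : (z:ℂ) ≠ 0 := by exact_mod_cast hz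
      have := Real.pi_ne_zero
      simp [*]
    rw [integral_exp_mul_complex hne]
    have : Complex.exp (-2 * Real.pi * z * I * (1:ℝ)) = 1 := by
      rw [Complex.exp_eq_one_iff]
      exact ⟨-z, by push_cast; ring⟩
    rw [this]
    simp

lemma phiS_decay (k N : ℕ) : ∃ C : ℝ, 0 < C ∧ ∀ t : ℝ, (1 + t^2)^N * ‖phiS k t‖ ≤ C := by
  obtain ⟨C, hC⟩ : ∃ C, ∀ t : ℝ, (1 + ‖t‖)^(2*N) * ‖iteratedFDeriv ℝ 0 (phiS k) t‖ ≤ C :=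
    ⟨_, fun t => SchwartzMap.one_add_le_sup_seminorm_apply (𝕜 := ℝ) (m := (2*N, 0)) le_rfl le_rfl (phiS k) t⟩
  refine ⟨max C 1, by positivity, fun t => le_trans ?_ ((hC t).trans (le_max_left _ _))⟩
  rw [norm_iteratedFDeriv_zero, pow_mul]
  gcongr
  rw [Real.norm_eq_abs]
  nlinarith [abs_nonneg t, sq_abs t]

end TS

namespace TS
open MeasureTheory Complex FourierTransform SchwartzMap

/-- The weight `1 + |ξ|²`. -/
noncomputable def W {n : ℕ} (ξ : Fin n → ℝ) : ℝ := 1 + ∑ i, ξ i ^ 2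

/-- The cast `ℤⁿ → ℝⁿ`. -/
def cz {n : ℕ} (η : Fin n → ℤ) : Fin n → ℝ := fun i => (η i : ℝ)

lemma W_ge_one {n : ℕ} (ξ : Fin n → ℝ) : 1 ≤ W ξ := by
  unfold W
  have : 0 ≤ ∑ i, ξ i ^ 2 := Finset.sum_nonneg fun i _ => sq_nonneg _
  linarith

lemma W_pos {n : ℕ} (ξ : Fin n → ℝ) : 0 < W ξ := lt_of_lt_of_le one_pos (W_ge_one ξ)

lemma W_neg {n : ℕ} (ξ : Fin n → ℝ) : W (-ξ) = W ξ := by simp [W]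

lemma W_sub_comm {n : ℕ} (ξ ζ : Fin n → ℝ) : W (ξ - ζ) = W (ζ - ξ) := by
  rw [← W_neg, neg_sub]

lemma W_add_le {n : ℕ} (ξ ζ : Fin n → ℝ) : W (ξ + ζ) ≤ 2 * W ξ * W ζ := by
  have h1 : ∑ i, (ξ + ζ) i ^ 2 ≤ 2 * ∑ i, ξ i ^ 2 + 2 * ∑ i, ζ i ^ 2 := by
    rw [Finset.mul_sum, Finset.mul_sum, ← Finset.sum_add_distrib]
    apply Finset.sum_le_sum
    intro i _
    simp only [Pi.add_apply]
    nlinarith [sq_nonneg (ξ i - ζ i)]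
  have h2 : 0 ≤ ∑ i, ξ i ^ 2 := Finset.sum_nonneg fun i _ => sq_nonneg _
  have h3 : 0 ≤ ∑ i, ζ i ^ 2 := Finset.sum_nonneg fun i _ => sq_nonneg _
  unfold W
  nlinarith [mul_nonneg h2 h3]

lemma W_le_mul_sub {n : ℕ} (ξ ζ : Fin n → ℝ) : W ξ ≤ 2 * W ζ * W (ζ - ξ) := by
  have := W_add_le ζ (ξ - ζ)
  rwa [add_sub_cancel, W_sub_comm] at this

lemma W_le_of_norm {n : ℕ} (ξ : Fin n → ℝ) (r : ℝ) (h : ‖ξ‖ ≤ r) : W ξ ≤ 1 + n * r ^ 2 := by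
  unfold W
  have : ∑ i, ξ i ^ 2 ≤ ∑ _i : Fin n, r ^ 2 := by
    apply Finset.sum_le_sum
    intro i _
    have h1 : |ξ i| ≤ r := (norm_le_pi_norm ξ i).trans h
    rw [← sq_abs]
    gcongr
  simpa using this

lemma peetre {n : ℕ} (ξ η : Fin n → ℝ) (s : ℝ) (L : ℕ) (hL : |s| ≤ L) :
    W η ^ s ≤ 2 ^ L * W ξ ^ s * W (ξ - η) ^ L := by
  have key : ∀ t : ℝ, 0 ≤ t → t ≤ L → ∀ ξ η : Fin n → ℝ,
      W η ^ t ≤ 2 ^ L * W ξ ^ t * W (ξ - η) ^ L := by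
    intro t ht htL ξ η
    calc W η ^ t ≤ (2 * W ξ * W (ξ - η)) ^ t :=
          Real.rpow_le_rpow (W_pos _).le (W_le_mul_sub η ξ) ht
      _ = 2 ^ t * W ξ ^ t * W (ξ - η) ^ t := by
          rw [Real.mul_rpow (by have := W_pos ξ; positivity) (W_pos _).le,
            Real.mul_rpow (by norm_num) (W_pos _).le]
      _ ≤ 2 ^ L * W ξ ^ t * W (ξ - η) ^ L := by
          have h1 : (2:ℝ) ^ t ≤ 2 ^ L := by
            rw [← Real.rpow_natCast]
            exact Real.rpow_le_rpow_of_exponent_le (by norm_num) htL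
          have h2 : W (ξ - η) ^ t ≤ W (ξ - η) ^ L := by
            rw [← Real.rpow_natCast]
            exact Real.rpow_le_rpow_of_exponent_le (W_ge_one _) htL
          have := Real.rpow_pos_of_pos (W_pos ξ) t
          have := Real.rpow_pos_of_pos (W_pos (ξ - η)) t
          gcongr
  rcases le_total 0 s with hs | hs
  · exact key s hs (by rwa [abs_of_nonneg hs] at hL) ξ η
  · have h := key (-s) (by linarith) (by rwa [abs_of_nonpos hs] at hL) η ξ
    rw [Real.rpow_neg (W_pos _).le, Real.rpow_neg (W_pos _).le, W_sub_comm] at h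
    have h1 := Real.rpow_pos_of_pos (W_pos ξ) s
    have h2 := Real.rpow_pos_of_pos (W_pos η) s
    rw [inv_le_iff_one_le_mul₀ h1] at h
    calc W η ^ s = W η ^ s * 1 := by ring
      _ ≤ W η ^ s * (2 ^ L * (W η ^ s)⁻¹ * W (ξ - η) ^ L * W ξ ^ s) := by gcongr
      _ = _ := by field_simp

lemma summable_pi_prod {n : ℕ} (u : ℤ → ℝ) (hu0 : ∀ z, 0 ≤ u z) (hu : Summable u) :
    Summable fun η : Fin n → ℤ => ∏ i, u (η i) := by
  classical
  refine summable_of_sum_le (c := ∏ _i : Fin n, ∑' z, u z)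
    (fun η => Finset.prod_nonneg fun i _ => hu0 _) ?_
  intro s
  calc ∑ η ∈ s, ∏ i, u (η i)
      ≤ ∑ η ∈ Fintype.piFinset (fun i => s.image fun η => η i), ∏ i, u (η i) := by
        apply Finset.sum_le_sum_of_subset_of_nonneg
        · intro η hη
          rw [Fintype.mem_piFinset]
          intro i
          exact Finset.mem_image_of_mem _ hη
        · intro η _ _
          exact Finset.prod_nonneg fun i _ => hu0 _
    _ = ∏ i, ∑ z ∈ s.image (fun η => η i), u z := by
        rw [Finset.prod_univ_sum]
    _ ≤ _ := by
        apply Finset.prod_le_prod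
        · intro i _
          exact Finset.sum_nonneg fun z _ => hu0 z
        · intro i _
          exact hu.sum_le_tsum _ fun z _ => hu0 z

lemma summable_W {n : ℕ} : Summable fun η : Fin n → ℤ => (W (cz η) ^ n)⁻¹ := by
  have h1 : Summable fun z : ℤ => (1 + (z:ℝ) ^ 2)⁻¹ := by
    refine Summable.of_nonneg_of_le (fun z => by positivity) (fun z => ?_)
      ((Real.summable_one_div_int_pow (p := 2)).2 (by norm_num) |>.add
        (summable_of_hasFiniteSupport (f := fun z : ℤ => if z = 0 then (1:ℝ) else 0)
          (Set.Finite.subset (Set.finite_singleton 0) (by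
            intro z hz; by_contra h; apply hz; simp at h; simp [h]))))
    by_cases hz : z = 0
    · simp [hz]
    · simp only [hz, if_false, add_zero, one_div]
      have : (0:ℝ) < (z:ℝ)^2 := by positivity
      gcongr
      linarith
  refine Summable.of_nonneg_of_le (fun η => by have := W_pos (cz η); positivity) (fun η => ?_)
    (summable_pi_prod _ (fun z => by positivity) h1)
  rw [Finset.prod_inv_distrib]
  have h2 : ∏ i, (1 + (η i : ℝ)^2) ≤ W (cz η) ^ n := by
    calc ∏ i, (1 + (η i : ℝ)^2) ≤ ∏ _i : Fin n, W (cz η) := by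
          apply Finset.prod_le_prod
          · intro i _; positivity
          · intro i _
            unfold W cz
            have := Finset.single_le_sum (f := fun i => (η i : ℝ)^2) (fun i _ => sq_nonneg _)
              (Finset.mem_univ i)
            simpa using this
      _ = _ := by simp
  have h3 : 0 < ∏ i, (1 + (η i : ℝ)^2) := Finset.prod_pos fun i _ => by positivity
  gcongr

lemma inv_W_le {n : ℕ} (ξ ζ η : Fin n → ℝ) (r : ℝ) (h : ‖ζ - ξ‖ ≤ r) :
    (W (ξ - η) ^ n)⁻¹ ≤ (2 * (1 + n * r ^ 2)) ^ n * (W (ζ - η) ^ n)⁻¹ := by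
  have h1 : W (ζ - η) ≤ 2 * (1 + n * r^2) * W (ξ - η) := by
    have p1 := W_pos (ξ - η)
    have h2 := W_le_of_norm _ _ h
    have := W_add_le (ζ - ξ) (ξ - η)
    rw [sub_add_sub_cancel] at this
    refine this.trans ?_
    gcongr
  have p1 := W_pos (ξ - η)
  have p2 := W_pos (ζ - η)
  rw [inv_le_iff_one_le_mul₀ (by positivity), mul_assoc, inv_mul_eq_div, mul_div_assoc', le_div_iff₀ (by positivity),
    one_mul, ← mul_pow]
  gcongr

lemma tsum_W_bound {n : ℕ} : ∃ C : ℝ, 0 < C ∧ ∀ ξ : Fin n → ℝ,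
    Summable (fun η : Fin n → ℤ => (W (ξ - cz η) ^ n)⁻¹) ∧
      ∑' η : Fin n → ℤ, (W (ξ - cz η) ^ n)⁻¹ ≤ C := by
  set S := ∑' η : Fin n → ℤ, (W (cz η) ^ n)⁻¹ with hS
  have hS0 : 0 ≤ S := tsum_nonneg fun η => by have := W_pos (cz η); positivity
  refine ⟨(2 * (1 + n * 1 ^ 2)) ^ n * S + 1, by positivity, fun ξ => ?_⟩
  set k : Fin n → ℤ := fun i => ⌊ξ i⌋ with hk
  have hle : ∀ η : Fin n → ℤ, (W (ξ - cz η) ^ n)⁻¹ ≤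
      (2 * (1 + n * 1 ^ 2)) ^ n * (W (cz (k - η)) ^ n)⁻¹ := by
    intro η
    have e : cz (k - η) = cz k - cz η := by ext i; simp [cz]
    rw [e]
    apply inv_W_le
    rw [pi_norm_le_iff_of_nonneg zero_le_one]
    intro i
    simp only [hk, cz, Pi.sub_apply, Real.norm_eq_abs]
    rw [abs_le]
    constructor <;> linarith [Int.floor_le (ξ i), Int.lt_floor_add_one (ξ i)]
  have hs1 : Summable fun η : Fin n → ℤ => (W (cz (k - η)) ^ n)⁻¹ :=
    (Equiv.subLeft k).summable_iff.2 summable_W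
  have hs2 := hs1.mul_left ((2 * (1 + (n:ℝ) * 1 ^ 2)) ^ n)
  have hs3 := Summable.of_nonneg_of_le (fun η => by have := W_pos (ξ - cz η); positivity) hle hs2
  refine ⟨hs3, ?_⟩
  calc _ ≤ _ := hs3.tsum_le_tsum hle hs2
    _ = (2 * (1 + n * 1 ^ 2)) ^ n * S := by
      rw [tsum_mul_left, hS]
      congr 1
      exact (Equiv.subLeft k).tsum_eq (fun η => (W (cz η) ^ n)⁻¹)
    _ ≤ _ := by linarith

/-- Standard basis vector in `ℝⁿ`. -/
def eR {n : ℕ} (j : Fin n) : Fin n → ℝ := fun i => if i = j then 1 else 0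
/-- Standard basis vector in `ℤⁿ`. -/
def eZ {n : ℕ} (j : Fin n) : Fin n → ℤ := fun i => if i = j then 1 else 0
/-- Standard basis multi-index. -/
def eN {n : ℕ} (j : Fin n) : Fin n → ℕ := fun i => if i = j then 1 else 0

lemma cz_add {n : ℕ} (ξ η : Fin n → ℤ) : cz (ξ + η) = cz ξ + cz η := by ext i; simp [cz]
lemma cz_eZ {n : ℕ} (j : Fin n) : cz (eZ j) = eR j := by
  ext i; simp [cz, eZ, eR]

/-- The tensor product kernel. -/
noncomputable def K {n : ℕ} (κ : Fin n → ℕ) (ξ : Fin n → ℝ) : ℂ := ∏ i, phiS (κ i) (ξ i)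

lemma K_decay {n : ℕ} (κ : Fin n → ℕ) (N : ℕ) :
    ∃ C : ℝ, 0 < C ∧ ∀ ξ, ‖K κ ξ‖ ≤ C * (W ξ ^ N)⁻¹ := by
  choose C hC0 hC using fun i => phiS_decay (κ i) N
  refine ⟨∏ i, C i, Finset.prod_pos fun i _ => hC0 i, fun ξ => ?_⟩
  rw [← div_eq_mul_inv, le_div_iff₀ (by have := W_pos ξ; positivity)]
  have h1 : W ξ ≤ ∏ i, (1 + ξ i ^ 2) := by
    unfold W
    have key : ∀ s : Finset (Fin n), 1 + ∑ i ∈ s, ξ i ^ 2 ≤ ∏ i ∈ s, (1 + ξ i ^ 2) := by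
      intro s
      induction s using Finset.induction_on with
      | empty => simp
      | insert i s hi ih =>
        rw [Finset.sum_insert hi, Finset.prod_insert hi]
        have h0 : 0 ≤ ∑ i ∈ s, ξ i ^ 2 := Finset.sum_nonneg fun i _ => sq_nonneg _
        nlinarith [sq_nonneg (ξ i), mul_nonneg (sq_nonneg (ξ i)) h0]
    exact key Finset.univ
  calc ‖K κ ξ‖ * W ξ ^ N ≤ ‖K κ ξ‖ * (∏ i, (1 + ξ i ^ 2)) ^ N := by
        have := W_pos ξ
        gcongr
    _ = ∏ i, ((1 + ξ i ^ 2)^N * ‖phiS (κ i) (ξ i)‖) := by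
        rw [K, norm_prod, ← Finset.prod_pow, ← Finset.prod_mul_distrib]
        exact Finset.prod_congr rfl fun i _ => mul_comm _ _
    _ ≤ _ := Finset.prod_le_prod (fun i _ => by positivity) (fun i _ => hC i _)

/-- Coordinate projection. -/
noncomputable def pj {n : ℕ} (j : Fin n) : (Fin n → ℝ) →L[ℝ] ℝ := ContinuousLinearMap.proj j

lemma K_hasFDerivAt {n : ℕ} (κ : Fin n → ℕ) (ξ : Fin n → ℝ) :
    HasFDerivAt (K κ) (∑ j, (pj j).smulRight (K (κ + eN j) (ξ + eR j) - K (κ + eN j) ξ)) ξ := by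
  classical
  have h : ∀ i : Fin n, HasFDerivAt (fun ξ : Fin n → ℝ => phiS (κ i) (ξ i))
      ((pj i).smulRight (phiS (κ i + 1) (ξ i + 1) - phiS (κ i + 1) (ξ i))) ξ := by
    intro i
    have h1 := (phiS_deriv (κ i) (ξ i)).hasFDerivAt
    have h2 : HasFDerivAt (fun ξ : Fin n → ℝ => ξ i) (pj i) ξ := (pj i).hasFDerivAt
    have h3 := h1.comp ξ h2
    refine HasFDerivAt.congr_fderiv h3 ?_
    ext v
    simp
  have h2 := HasFDerivAt.finsetProd (u := Finset.univ) (fun i _ => h i)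
  unfold K
  refine HasFDerivAt.congr_fderiv h2 ?_
  symm
  apply Finset.sum_congr rfl
  intro j _
  ext v
  have e1 : ∀ ζ : Fin n → ℝ, ∏ i, phiS ((κ + eN j) i) (ζ i) =
    phiS (κ j + 1) (ζ j) * ∏ i ∈ Finset.univ.erase j, phiS (κ i) (ζ i) := by
    intro ζ
    rw [← Finset.mul_prod_erase _ _ (Finset.mem_univ j)]
    congr 1
    · simp [eN]
    · apply Finset.prod_congr rfl
      intro i hi
      have := Finset.ne_of_mem_erase hi
      simp [eN, this]
  rw [e1, e1]
  have e2 : ∏ i ∈ Finset.univ.erase j, phiS (κ i) ((ξ + eR j) i) =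
      ∏ i ∈ Finset.univ.erase j, phiS (κ i) (ξ i) := by
    apply Finset.prod_congr rfl
    intro i hi
    have := Finset.ne_of_mem_erase hi
    simp [eR, this]
  rw [e2]
  simp [eR]
  ring

lemma K_int {n : ℕ} (ξ : Fin n → ℤ) : K 0 (cz ξ) = if ξ = 0 then 1 else 0 := by
  unfold K cz
  simp only [Pi.zero_apply, phiS_int]
  split_ifs with h
  · simp [h]
  · have : ∃ i, ξ i ≠ 0 := by
      by_contra hh; push Not at hh; exact h (funext hh)
    obtain ⟨i, hi⟩ := this
    exact Finset.prod_eq_zero (Finset.mem_univ i) (by simp [hi])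

end TS

namespace TS

/-- Iterated application of a family of operators, indexed by a multi-index. -/
def opf {n : ℕ} {X : Type*} (T : Fin n → X → X) (α : Fin n → ℕ) (l : List (Fin n)) (f : X) : X :=
  l.foldr (fun j g => (T j)^[α j] g) f

lemma opf_nil {n : ℕ} {X : Type*} (T : Fin n → X → X) (α : Fin n → ℕ) (f : X) :
    opf T α [] f = f := rfl

lemma opf_cons {n : ℕ} {X : Type*} (T : Fin n → X → X) (α : Fin n → ℕ) (j : Fin n)
    (l : List (Fin n)) (f : X) :
    opf T α (j :: l) f = (T j)^[α j] (opf T α l f) := rfl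

lemma mderiv_eq {n : ℕ} (β : Fin n → ℕ) (f : (Fin n → ℝ) → ℂ) :
    mderiv β f = opf dline β (List.finRange n) f := rfl

lemma mdiff_eq {n : ℕ} (β : Fin n → ℕ) (f : (Fin n → ℤ) → ℂ) :
    mdiff β f = opf fdiff β (List.finRange n) f := rfl

lemma opf_zero {n : ℕ} {X : Type*} (T : Fin n → X → X) (l : List (Fin n)) (f : X) :
    opf T 0 l f = f := by
  induction l with
  | nil => rfl
  | cons j l ih => rw [opf_cons, ih]; rfl

section gen
variable {n : ℕ} {X Y : Type*}

/-- A relation between elements preserved by the operators is preserved by the fold. -/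
lemma opf_rel (R : X → Y → Prop) (T : Fin n → X → X) (S : Fin n → Y → Y)
    (h : ∀ j f g, R f g → R (T j f) (S j g)) (α : Fin n → ℕ) (l : List (Fin n))
    (f : X) (g : Y) (hfg : R f g) : R (opf T α l f) (opf S α l g) := by
  have hit : ∀ j k f g, R f g → R ((T j)^[k] f) ((S j)^[k] g) := by
    intro j k
    induction k with
    | zero => intro f g h; exact h
    | succ k ih =>
      intro f g hfg
      rw [Function.iterate_succ_apply, Function.iterate_succ_apply]
      exact ih _ _ (h j f g hfg)
  induction l with
  | nil => exact hfg
  | cons j l ih => exact hit _ _ _ _ ih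

lemma opf_pres (P : X → Prop) (T : Fin n → X → X) (h : ∀ j f, P f → P (T j f))
    (α : Fin n → ℕ) (l : List (Fin n)) (f : X) (hf : P f) : P (opf T α l f) :=
  opf_rel (fun f (_ : X) => P f) T T (fun j f _ hf => h j f hf) α l f f hf

lemma opf_comm (P : X → Prop) (T : Fin n → X → X) (hT : ∀ j f, P f → P (T j f))
    (S : X → X) (h : ∀ j f, P f → S (T j f) = T j (S f))
    (α : Fin n → ℕ) (l : List (Fin n)) (f : X) (hf : P f) :
    S (opf T α l f) = opf T α l (S f) := by
  have := opf_rel (fun f g => P f ∧ S f = g) T T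
    (fun j f g hfg => ⟨hT j f hfg.1, by rw [h j f hfg.1, hfg.2]⟩) α l f (S f) ⟨hf, rfl⟩
  exact this.2

lemma iter_comm (P : X → Prop) (T S : X → X) (hT : ∀ f, P f → P (T f))
    (h : ∀ f, P f → S (T f) = T (S f)) (k : ℕ) (f : X) (hf : P f) :
    S (T^[k] f) = T^[k] (S f) := by
  induction k generalizing f with
  | zero => rfl
  | succ k ih =>
    rw [Function.iterate_succ_apply, Function.iterate_succ_apply, ih _ (hT f hf), h f hf]

lemma opf_congr (T : Fin n → X → X) (α β : Fin n → ℕ) (l : List (Fin n))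
    (h : ∀ j ∈ l, α j = β j) (f : X) : opf T α l f = opf T β l f := by
  induction l with
  | nil => rfl
  | cons i l ih =>
    rw [opf_cons, opf_cons, ih (fun j hj => h j (List.mem_cons_of_mem _ hj)),
      h i List.mem_cons_self]

lemma opf_succ (P : X → Prop) (T : Fin n → X → X) (hT : ∀ j f, P f → P (T j f))
    (h : ∀ i j f, P f → T i (T j f) = T j (T i f))
    (α : Fin n → ℕ) (j : Fin n) (l : List (Fin n)) (hl : l.Nodup) (hj : j ∈ l) (f : X) (hf : P f) :
    opf T α l (T j f) = opf T (α + eN j) l f := by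
  induction l with
  | nil => simp at hj
  | cons i l ih =>
    rw [opf_cons, opf_cons]
    rw [List.nodup_cons] at hl
    by_cases hij : i = j
    · subst hij
      rw [opf_congr T (α + eN i) α l]
      · rw [← opf_comm P T hT (T i) (fun j f hf => h i j f hf) α l f hf]
        have : (α + eN i) i = α i + 1 := by simp [eN]
        rw [this, Function.iterate_succ_apply]
      · intro k hk
        have : k ≠ i := fun e => hl.1 (e ▸ hk)
        simp [eN, this]
    · have hj' : j ∈ l := by
        rcases List.mem_cons.1 hj with h | h
        · exact absurd h.symm hij
        · exact h
      rw [ih hl.2 hj']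
      have : (α + eN j) i = α i := by simp [eN, hij]
      rw [this]

lemma opf_opf_comm (P : X → Prop) (T S : Fin n → X → X) (hT : ∀ j f, P f → P (T j f))
    (hS : ∀ j f, P f → P (S j f))
    (h : ∀ i j f, P f → S i (T j f) = T j (S i f))
    (α β : Fin n → ℕ) (l l' : List (Fin n)) (f : X) (hf : P f) :
    opf S β l' (opf T α l f) = opf T α l (opf S β l' f) := by
  refine opf_comm P T hT (opf S β l') (fun j f hf => ?_) α l f hf
  exact (opf_comm P S hS (T j) (fun i f hf => (h i j f hf).symm) β l' f hf).symm

end gen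

/-! ### Directional derivatives -/

abbrev Smooth {E : Type*} [NormedAddCommGroup E] [NormedSpace ℝ E] (f : E → ℂ) : Prop :=
  ContDiff ℝ (⊤ : ℕ∞) f

lemma Smooth.diff {E : Type*} [NormedAddCommGroup E] [NormedSpace ℝ E] {f : E → ℂ}
    (hf : ContDiff ℝ (⊤ : ℕ∞) f) : Differentiable ℝ f :=
  hf.differentiable (by simp)

lemma smooth_fderiv {E : Type*} [NormedAddCommGroup E] [NormedSpace ℝ E] {f : E → ℂ}
    (hf : Smooth f) (v : E) : Smooth (fun x => fderiv ℝ f x v) :=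
  (hf.fderiv_right (m := (⊤:ℕ∞)) (by simp)).clm_apply contDiff_const

lemma fderiv_comm {E : Type*} [NormedAddCommGroup E] [NormedSpace ℝ E] {f : E → ℂ}
    (hf : Smooth f) (v w : E) :
    (fun x => fderiv ℝ (fun y => fderiv ℝ f y v) x w) =
      fun x => fderiv ℝ (fun y => fderiv ℝ f y w) x v := by
  ext x
  have h1 : Differentiable ℝ (fderiv ℝ f) :=
    (hf.fderiv_right (m := (⊤:ℕ∞)) (by simp)).differentiable (by simp)
  have h2 : ∀ u : E, fderiv ℝ (fun y => fderiv ℝ f y u) x = (fderiv ℝ (fderiv ℝ f) x).flip u := by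
    intro u
    have := fderiv_clm_apply (h1 x) (differentiableAt_const (𝕜 := ℝ) u)
    rw [this]
    simp
  rw [h2, h2]
  have := ((contDiff_infty.1 hf 2).contDiffAt (x := x)).isSymmSndFDerivAt (by simp)
  exact this w v

lemma dline_eq {n : ℕ} (j : Fin n) (f : (Fin n → ℝ) → ℂ) :
    dline j f = fun x => fderiv ℝ f x (eR j) := rfl

lemma dline_smooth {n : ℕ} (j : Fin n) (f : (Fin n → ℝ) → ℂ) (hf : Smooth f) :
    Smooth (dline j f) := smooth_fderiv hf _

lemma dline_comm {n : ℕ} (i j : Fin n) (f : (Fin n → ℝ) → ℂ) (hf : Smooth f) :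
    dline i (dline j f) = dline j (dline i f) := fderiv_comm hf _ _

lemma mderiv_dline {n : ℕ} (β : Fin n → ℕ) (j : Fin n) (f : (Fin n → ℝ) → ℂ) (hf : Smooth f) :
    mderiv β (dline j f) = mderiv (β + eN j) f :=
  opf_succ Smooth dline dline_smooth dline_comm β j _ (List.nodup_finRange n)
    (List.mem_finRange j) f hf

/-- Derivative in the first variable. -/
noncomputable def dX {n : ℕ} {Y : Type*} (j : Fin n) (b : (Fin n → ℝ) → Y → ℂ) :
    (Fin n → ℝ) → Y → ℂ := fun x η => dline j (fun y => b y η) x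

/-- Derivative in the second variable. -/
noncomputable def dXi {n : ℕ} {Y : Type*} (j : Fin n) (b : Y → (Fin n → ℝ) → ℂ) :
    Y → (Fin n → ℝ) → ℂ := fun x => dline j (b x)

/-- Difference in the second variable. -/
def dN {n : ℕ} {Y : Type*} (j : Fin n) (b : Y → (Fin n → ℤ) → ℂ) :
    Y → (Fin n → ℤ) → ℂ := fun x => fdiff j (b x)

lemma opf_dX {n : ℕ} {Y : Type*} (β : Fin n → ℕ) (l : List (Fin n)) (b : (Fin n → ℝ) → Y → ℂ)
    (x : Fin n → ℝ) (η : Y) : opf dX β l b x η = opf dline β l (fun y => b y η) x := by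
  have := opf_rel (fun (b : (Fin n → ℝ) → Y → ℂ) f => (fun y => b y η) = f) dX dline
    (fun j b f h => by subst h; rfl) β l b _ rfl
  exact congrFun this x

lemma opf_dXi {n : ℕ} {Y : Type*} (β : Fin n → ℕ) (l : List (Fin n)) (b : Y → (Fin n → ℝ) → ℂ)
    (x : Y) : opf dXi β l b x = opf dline β l (b x) :=
  opf_rel (fun (b : Y → (Fin n → ℝ) → ℂ) f => b x = f) dXi dline
    (fun j b f h => by subst h; rfl) β l b _ rfl

lemma opf_dN {n : ℕ} {Y : Type*} (β : Fin n → ℕ) (l : List (Fin n)) (b : Y → (Fin n → ℤ) → ℂ)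
    (x : Y) : opf dN β l b x = opf fdiff β l (b x) :=
  opf_rel (fun (b : Y → (Fin n → ℤ) → ℂ) f => b x = f) dN fdiff
    (fun j b f h => by subst h; rfl) β l b _ rfl

/-- Smoothness in `x` for each `η`. -/
def SmX {n : ℕ} {Y : Type*} (b : (Fin n → ℝ) → Y → ℂ) : Prop := ∀ η, Smooth fun x => b x η

lemma SmX_dX {n : ℕ} {Y : Type*} (j : Fin n) (b : (Fin n → ℝ) → Y → ℂ) (hb : SmX b) :
    SmX (dX j b) := fun η => dline_smooth j _ (hb η)

lemma SmX_dN {n : ℕ} (j : Fin n) (b : (Fin n → ℝ) → (Fin n → ℤ) → ℂ) (hb : SmX b) :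
    SmX (dN j b) := fun _ => (hb _).sub (hb _)

lemma dX_dN {n : ℕ} (i j : Fin n) (b : (Fin n → ℝ) → (Fin n → ℤ) → ℂ) (hb : SmX b) :
    dX i (dN j b) = dN j (dX i b) := by
  ext x η
  simp only [dX, dN, fdiff, dline]
  rw [fderiv_fun_sub (Smooth.diff (hb _) x) (Smooth.diff (hb _) x)]
  rfl

lemma mderiv_mdiff {n : ℕ} (α β : Fin n → ℕ) (b : (Fin n → ℝ) → (Fin n → ℤ) → ℂ) (hb : SmX b)
    (x : Fin n → ℝ) (ξ : Fin n → ℤ) :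
    mderiv β (fun y => mdiff α (b y) ξ) x = mdiff α (fun η => mderiv β (fun y => b y η) x) ξ := by
  have h := opf_opf_comm SmX dN dX SmX_dN SmX_dX (fun i j f hf => dX_dN i j f hf) α β
    (List.finRange n) (List.finRange n) b hb
  have h1 := congrFun (congrFun h x) ξ
  rw [opf_dX] at h1
  rw [opf_dN] at h1
  simp only [mderiv_eq, mdiff_eq]
  have e1 : (fun y => opf dN α (List.finRange n) b y ξ) =
    fun y => opf fdiff α (List.finRange n) (b y) ξ := by
    ext y; rw [opf_dN]
  have e2 : opf dX β (List.finRange n) b x =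
    fun η => opf dline β (List.finRange n) (fun y => b y η) x := by
    ext η; rw [opf_dX]
  rw [e1, e2] at h1
  exact h1

/-- Joint smoothness. -/
def SmJ {n : ℕ} (b : (Fin n → ℝ) → (Fin n → ℝ) → ℂ) : Prop :=
  Smooth fun p : (Fin n → ℝ) × (Fin n → ℝ) => b p.1 p.2

lemma dX_joint {n : ℕ} (j : Fin n) (b : (Fin n → ℝ) → (Fin n → ℝ) → ℂ) (hb : SmJ b)
    (p : (Fin n → ℝ) × (Fin n → ℝ)) :
    dX j b p.1 p.2 = fderiv ℝ (fun p : (Fin n → ℝ) × (Fin n → ℝ) => b p.1 p.2) p (eR j, 0) := by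
  have h1 := (Smooth.diff hb p).hasFDerivAt
  have h2 : HasFDerivAt (fun y : Fin n → ℝ => (y, p.2)) (ContinuousLinearMap.inl ℝ _ _) p.1 :=
    hasFDerivAt_prodMk_left _ _
  have h3 := HasFDerivAt.comp (g := fun p : (Fin n → ℝ) × (Fin n → ℝ) => b p.1 p.2) p.1 h1 h2
  simp only [dX, dline]
  have h4 : fderiv ℝ (fun y => b y p.2) p.1 = _ := h3.fderiv
  rw [h4]
  rfl

lemma dXi_joint {n : ℕ} (j : Fin n) (b : (Fin n → ℝ) → (Fin n → ℝ) → ℂ) (hb : SmJ b)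
    (p : (Fin n → ℝ) × (Fin n → ℝ)) :
    dXi j b p.1 p.2 = fderiv ℝ (fun p : (Fin n → ℝ) × (Fin n → ℝ) => b p.1 p.2) p (0, eR j) := by
  have h1 := (Smooth.diff hb p).hasFDerivAt
  have h2 : HasFDerivAt (fun y : Fin n → ℝ => (p.1, y)) (ContinuousLinearMap.inr ℝ _ _) p.2 :=
    hasFDerivAt_prodMk_right _ _
  have h3 := HasFDerivAt.comp (g := fun p : (Fin n → ℝ) × (Fin n → ℝ) => b p.1 p.2) p.2 h1 h2
  simp only [dXi, dline]
  have h4 : fderiv ℝ (b p.1) p.2 = _ := h3.fderiv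
  rw [h4]
  rfl

lemma SmJ_dX {n : ℕ} (j : Fin n) (b : (Fin n → ℝ) → (Fin n → ℝ) → ℂ) (hb : SmJ b) :
    SmJ (dX j b) := by
  unfold SmJ
  simp_rw [dX_joint j b hb]
  exact smooth_fderiv hb _

lemma SmJ_dXi {n : ℕ} (j : Fin n) (b : (Fin n → ℝ) → (Fin n → ℝ) → ℂ) (hb : SmJ b) :
    SmJ (dXi j b) := by
  unfold SmJ
  simp_rw [dXi_joint j b hb]
  exact smooth_fderiv hb _

lemma dX_dXi {n : ℕ} (i j : Fin n) (b : (Fin n → ℝ) → (Fin n → ℝ) → ℂ) (hb : SmJ b) :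
    dX i (dXi j b) = dXi j (dX i b) := by
  ext x ξ
  have h1 := dX_joint i _ (SmJ_dXi j b hb) (x, ξ)
  have h2 := dXi_joint j _ (SmJ_dX i b hb) (x, ξ)
  simp_rw [dXi_joint j b hb] at h1
  simp_rw [dX_joint i b hb] at h2
  rw [congrFun (fderiv_comm hb _ _) _] at h1
  exact h1.trans h2.symm

lemma SmJ_right {n : ℕ} (b : (Fin n → ℝ) → (Fin n → ℝ) → ℂ) (hb : SmJ b) (x : Fin n → ℝ) :
    Smooth (b x) := by
  have h : ContDiff ℝ (⊤:ℕ∞) (fun p : (Fin n → ℝ) × (Fin n → ℝ) => b p.1 p.2) := hb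
  exact h.comp (contDiff_prodMk_right x)

lemma SmJ_left {n : ℕ} (b : (Fin n → ℝ) → (Fin n → ℝ) → ℂ) (hb : SmJ b) (ξ : Fin n → ℝ) :
    Smooth (fun x => b x ξ) := by
  have h : ContDiff ℝ (⊤:ℕ∞) (fun p : (Fin n → ℝ) × (Fin n → ℝ) => b p.1 p.2) := hb
  exact h.comp (contDiff_prodMk_left ξ)

lemma mderiv_mderiv {n : ℕ} (α β : Fin n → ℕ) (b : (Fin n → ℝ) → (Fin n → ℝ) → ℂ) (hb : SmJ b)
    (x : Fin n → ℝ) (ξ : Fin n → ℝ) :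
    mderiv β (fun y => mderiv α (fun η => b y η) ξ) x =
      mderiv α (fun η => mderiv β (fun y => b y η) x) ξ := by
  have h := opf_opf_comm SmJ dXi dX SmJ_dXi SmJ_dX (fun i j f hf => dX_dXi i j f hf) α β
    (List.finRange n) (List.finRange n) b hb
  have h1 := congrFun (congrFun h x) ξ
  rw [opf_dX] at h1
  rw [opf_dXi] at h1
  simp only [mderiv_eq]
  have e1 : (fun y => opf dXi α (List.finRange n) b y ξ) =
    fun y => opf dline α (List.finRange n) (b y) ξ := by
    ext y; rw [opf_dXi]
  have e2 : opf dX β (List.finRange n) b x =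
    fun η => opf dline β (List.finRange n) (fun y => b y η) x := by
    ext η; rw [opf_dX]
  rw [e1, e2] at h1
  exact h1

lemma smooth_mderiv_left {n : ℕ} (β : Fin n → ℕ) (b : (Fin n → ℝ) → (Fin n → ℝ) → ℂ) (hb : SmJ b)
    (x : Fin n → ℝ) : Smooth (fun η => mderiv β (fun y => b y η) x) := by
  have h := SmJ_right _ (opf_pres SmJ dX SmJ_dX β (List.finRange n) b hb) x
  have e2 : opf dX β (List.finRange n) b x =
    fun η => opf dline β (List.finRange n) (fun y => b y η) x := by
    ext η; rw [opf_dX]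
  rw [e2] at h
  exact h

/-! ### Differences are controlled by derivatives -/

/-- Real forward difference. -/
def rd {n : ℕ} (j : Fin n) (f : (Fin n → ℝ) → ℂ) : (Fin n → ℝ) → ℂ := fun ξ => f (ξ + eR j) - f ξ

lemma rd_smooth {n : ℕ} (j : Fin n) (f : (Fin n → ℝ) → ℂ) (hf : Smooth f) : Smooth (rd j f) :=
  (hf.comp (contDiff_id.add contDiff_const)).sub hf

lemma rd_comm {n : ℕ} (i j : Fin n) (f : (Fin n → ℝ) → ℂ) : rd i (rd j f) = rd j (rd i f) := by
  ext ξ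
  simp only [rd]
  rw [add_right_comm ξ (eR i) (eR j)]
  ring

lemma dline_rd {n : ℕ} (i j : Fin n) (f : (Fin n → ℝ) → ℂ) (hf : Smooth f) :
    dline i (rd j f) = rd j (dline i f) := by
  ext ξ
  simp only [dline]
  unfold rd
  have h1 : DifferentiableAt ℝ (fun ξ => f (ξ + eR j)) ξ :=
    Smooth.diff (hf.comp (contDiff_id.add contDiff_const)) ξ
  rw [fderiv_fun_sub h1 (Smooth.diff hf ξ), fderiv_comp_add_right]
  rfl

lemma norm_eR_le {n : ℕ} (j : Fin n) : ‖eR j‖ ≤ 1 := by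
  rw [pi_norm_le_iff_of_nonneg zero_le_one]
  intro i
  unfold eR
  split_ifs <;> simp

lemma norm_rd_le {n : ℕ} (j : Fin n) (f : (Fin n → ℝ) → ℂ) (hf : Smooth f) (ξ : Fin n → ℝ) (M : ℝ)
    (h : ∀ ζ, ‖ζ - ξ‖ ≤ 1 → ‖dline j f ζ‖ ≤ M) : ‖rd j f ξ‖ ≤ M := by
  have hd : ∀ t ∈ Set.Icc (0:ℝ) 1, HasDerivWithinAt (fun t : ℝ => f (ξ + t • eR j))
      (dline j f (ξ + t • eR j)) (Set.Icc 0 1) t := by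
    intro t _
    apply HasDerivAt.hasDerivWithinAt
    have h1 := (Smooth.diff hf (ξ + t • eR j)).hasFDerivAt
    have h2 : HasDerivAt (fun t : ℝ => ξ + t • eR j) (eR j) t := by
      simpa using ((hasDerivAt_id t).smul_const (eR j)).const_add ξ
    exact h1.comp_hasDerivAt t h2
  have := norm_image_sub_le_of_norm_deriv_le_segment_01' (C := M) hd (by
    intro t ht
    apply h
    rw [add_sub_cancel_left, norm_smul, Real.norm_eq_abs, abs_of_nonneg ht.1]
    have := norm_eR_le j
    have := norm_nonneg (eR j)
    nlinarith [ht.1, ht.2])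
  simpa [rd] using this

/-- `A` is a difference operator controlled by the derivative operator `B`. -/
def Good {n : ℕ} (A B : ((Fin n → ℝ) → ℂ) → ((Fin n → ℝ) → ℂ)) : Prop :=
  (∃ r : ℝ, ∀ f, Smooth f → ∀ ξ M, (∀ ζ, ‖ζ - ξ‖ ≤ r → ‖B f ζ‖ ≤ M) → ‖A f ξ‖ ≤ M) ∧
  (∀ j f, Smooth f → B (rd j f) = rd j (B f)) ∧ (∀ j f, A (rd j f) = rd j (A f)) ∧
  ∀ f, Smooth f → Smooth (B f)

lemma good_step {n : ℕ} (j : Fin n) (A B : ((Fin n → ℝ) → ℂ) → ((Fin n → ℝ) → ℂ)) (h : Good A B) :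
    Good (fun f => rd j (A f)) (fun f => dline j (B f)) := by
  obtain ⟨⟨r, hr⟩, hB, hA, hs⟩ := h
  refine ⟨⟨r + 1, ?_⟩, ?_, ?_, ?_⟩
  · intro f hf ξ M hM
    beta_reduce
    rw [← hA]
    apply hr _ (rd_smooth j f hf)
    intro ζ hζ
    rw [hB _ _ hf]
    apply norm_rd_le _ _ (hs f hf)
    intro ζ' hζ'
    apply hM
    calc ‖ζ' - ξ‖ = ‖(ζ - ξ) + (ζ' - ζ)‖ := by congr 1; abel
      _ ≤ _ := norm_add_le _ _
      _ ≤ _ := by linarith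
  · intro i f hf
    simp only
    rw [hB _ _ hf, dline_rd _ _ _ (hs f hf)]
  · intro i f
    simp only
    rw [hA, rd_comm]
  · intro f hf
    exact dline_smooth _ _ (hs f hf)

lemma good_opf {n : ℕ} (α : Fin n → ℕ) (l : List (Fin n)) :
    Good (fun f => opf rd α l f) (fun f => opf dline α l f) := by
  have hit : ∀ j k (A B : ((Fin n → ℝ) → ℂ) → ((Fin n → ℝ) → ℂ)), Good A B →
      Good (fun f => (rd j)^[k] (A f)) (fun f => (dline j)^[k] (B f)) := by
    intro j k
    induction k with
    | zero => intro A B h; exact h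
    | succ k ih => intro A B h; exact ih _ _ (good_step j A B h)
  induction l with
  | nil =>
    refine ⟨⟨0, ?_⟩, fun _ _ _ => rfl, fun _ _ => rfl, fun f hf => hf⟩
    intro f _ ξ M h
    exact h ξ (by simp)
  | cons j l ih => exact hit j (α j) _ _ ih

lemma mdiff_bound {n : ℕ} (α : Fin n → ℕ) : ∃ r : ℝ, ∀ G : (Fin n → ℝ) → ℂ, Smooth G →
    ∀ (ξ : Fin n → ℤ) (M : ℝ), (∀ ζ, ‖ζ - cz ξ‖ ≤ r → ‖mderiv α G ζ‖ ≤ M) →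
      ‖mdiff α (fun η => G (cz η)) ξ‖ ≤ M := by
  obtain ⟨⟨r, hr⟩, -⟩ := good_opf α (List.finRange n)
  refine ⟨r, fun G hG ξ M h => ?_⟩
  have e := opf_rel (fun (f : (Fin n → ℝ) → ℂ) g => g = fun η : Fin n → ℤ => f (cz η)) rd fdiff
    (by
      intro j f g h
      subst h
      ext η
      simp only [fdiff, rd]
      rw [← cz_eZ, ← cz_add]
      rfl) α (List.finRange n) G _ rfl
  rw [mdiff_eq, e]
  exact hr G hG _ M h

end TS

namespace TS

/-- The interpolating series. -/
noncomputable def F {n : ℕ} (κ : Fin n → ℕ) (b : (Fin n → ℝ) → (Fin n → ℤ) → ℂ)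
    (x ξ : Fin n → ℝ) : ℂ := ∑' η : Fin n → ℤ, K κ (ξ - cz η) * b x η

lemma term_bound {n : ℕ} (κ : Fin n → ℕ) (b : (Fin n → ℝ) → (Fin n → ℤ) → ℂ) (C s : ℝ) (hC : 0 < C)
    (hb : ∀ x η, ‖b x η‖ ≤ C * W (cz η) ^ s) :
    ∃ D : ℝ, 0 < D ∧ ∀ x ξ η, ‖K κ (ξ - cz η) * b x η‖ ≤ D * W ξ ^ s * (W (ξ - cz η) ^ n)⁻¹ := by
  obtain ⟨L, hL⟩ := exists_nat_ge |s|
  obtain ⟨C1, hC1, h1⟩ := K_decay κ (L + n)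
  refine ⟨C1 * C * 2 ^ L, by positivity, fun x ξ η => ?_⟩
  have p1 := W_pos (ξ - cz η)
  have p2 := Real.rpow_pos_of_pos (W_pos ξ) s
  calc ‖K κ (ξ - cz η) * b x η‖ = ‖K κ (ξ - cz η)‖ * ‖b x η‖ := norm_mul _ _
    _ ≤ (C1 * (W (ξ - cz η) ^ (L + n))⁻¹) * (C * (2 ^ L * W ξ ^ s * W (ξ - cz η) ^ L)) := by
        have h2 := peetre ξ (cz η) s L hL
        have h3 : ‖b x η‖ ≤ C * (2 ^ L * W ξ ^ s * W (ξ - cz η) ^ L) :=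
          (hb x η).trans (by gcongr)
        have h4 := h1 (ξ - cz η)
        gcongr
    _ = _ := by
        rw [pow_add]
        field_simp

lemma F_bound {n : ℕ} (κ : Fin n → ℕ) (b : (Fin n → ℝ) → (Fin n → ℤ) → ℂ) (C s : ℝ) (hC : 0 < C)
    (hb : ∀ x η, ‖b x η‖ ≤ C * W (cz η) ^ s) :
    ∃ D : ℝ, 0 < D ∧ ∀ x ξ, ‖F κ b x ξ‖ ≤ D * W ξ ^ s := by
  obtain ⟨D, hD, h⟩ := term_bound κ b C s hC hb
  obtain ⟨S, hS, h2⟩ := tsum_W_bound (n := n)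
  refine ⟨D * S, by positivity, fun x ξ => ?_⟩
  have p2 := Real.rpow_pos_of_pos (W_pos ξ) s
  have h3 := tsum_of_norm_bounded (((h2 ξ).1.mul_left (D * W ξ ^ s)).hasSum) (h x ξ)
  refine h3.trans ?_
  rw [tsum_mul_left]
  calc _ ≤ D * W ξ ^ s * S := by
        gcongr
        exact (h2 ξ).2
    _ = _ := by ring

lemma local_bound {n : ℕ} (κ : Fin n → ℕ) (b : (Fin n → ℝ) → (Fin n → ℤ) → ℂ) (C s : ℝ) (hC : 0 < C)
    (hb : ∀ x η, ‖b x η‖ ≤ C * W (cz η) ^ s) (ξ₀ : Fin n → ℝ) :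
    ∃ u : (Fin n → ℤ) → ℝ, Summable u ∧ ∀ x ξ, ‖ξ - ξ₀‖ ≤ 1 →
      ∀ η, ‖K κ (ξ - cz η) * b x η‖ ≤ u η := by
  obtain ⟨D, hD, h⟩ := term_bound κ b C s hC hb
  obtain ⟨S, hS, h2⟩ := tsum_W_bound (n := n)
  obtain ⟨L, hL⟩ := exists_nat_ge |s|
  have p0 := Real.rpow_pos_of_pos (W_pos ξ₀) s
  refine ⟨fun η => D * (2 ^ L * W ξ₀ ^ s * (1 + n * 1 ^ 2) ^ L) *
    ((2 * (1 + n * 1 ^ 2)) ^ n * (W (ξ₀ - cz η) ^ n)⁻¹),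
    ((h2 ξ₀).1.mul_left _).mul_left _, fun x ξ hξ η => ?_⟩
  refine (h x ξ η).trans ?_
  have h3 := inv_W_le ξ ξ₀ (cz η) 1 (by rwa [norm_sub_rev])
  have h4 := peetre ξ₀ ξ s L hL
  have h5 := W_le_of_norm (ξ₀ - ξ) 1 (by rwa [norm_sub_rev])
  have p1 := W_pos (ξ - cz η)
  have p2 := Real.rpow_pos_of_pos (W_pos ξ) s
  have p3 := W_pos (ξ₀ - ξ)
  have h6 : W ξ ^ s ≤ 2 ^ L * W ξ₀ ^ s * (1 + n * 1 ^ 2) ^ L := h4.trans (by gcongr)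
  exact mul_le_mul (mul_le_mul_of_nonneg_left h6 hD.le) h3 (by positivity) (by positivity)

/-- Admissible coefficient families. -/
def Adm {n : ℕ} (b : (Fin n → ℝ) → (Fin n → ℤ) → ℂ) : Prop :=
  SmX b ∧ ∀ β : Fin n → ℕ, ∃ C s : ℝ, 0 < C ∧ ∀ x η,
    ‖mderiv β (fun y => b y η) x‖ ≤ C * W (cz η) ^ s

lemma Adm.bound {n : ℕ} {b : (Fin n → ℝ) → (Fin n → ℤ) → ℂ} (h : Adm b) :
    ∃ C s : ℝ, 0 < C ∧ ∀ x η, ‖b x η‖ ≤ C * W (cz η) ^ s := by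
  have := h.2 0
  simpa only [mderiv_eq, opf_zero] using this

lemma Adm.dX {n : ℕ} (j : Fin n) (b : (Fin n → ℝ) → (Fin n → ℤ) → ℂ) (h : Adm b) :
    Adm (dX j b) := by
  refine ⟨SmX_dX j b h.1, fun β => ?_⟩
  obtain ⟨C, s, hC, hb⟩ := h.2 (β + eN j)
  refine ⟨C, s, hC, fun x η => ?_⟩
  have := hb x η
  rw [← mderiv_dline _ _ _ (h.1 η)] at this
  exact this

lemma Adm.dN {n : ℕ} (j : Fin n) (b : (Fin n → ℝ) → (Fin n → ℤ) → ℂ) (h : Adm b) :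
    Adm (dN j b) := by
  refine ⟨SmX_dN j b h.1, fun β => ?_⟩
  obtain ⟨C, s, hC, hb⟩ := h.2 β
  obtain ⟨L, hL⟩ := exists_nat_ge |s|
  refine ⟨C * (2 ^ L * (1 + n * 1 ^ 2) ^ L) + C, s, by positivity, fun x η => ?_⟩
  have e : mderiv β (fun y => TS.dN j b y η) x =
      mderiv β (fun y => b y (η + eZ j)) x - mderiv β (fun y => b y η) x := by
    have h1 := opf_comm SmX TS.dX SmX_dX (TS.dN j) (fun i f hf => (dX_dN i j f hf).symm) β
      (List.finRange n) b h.1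
    have h2 := congrFun (congrFun h1 x) η
    rw [opf_dX] at h2
    rw [mderiv_eq, ← h2]
    simp only [TS.dN, fdiff]
    rw [opf_dX, opf_dX]
    rfl
  rw [e]
  refine (norm_sub_le _ _).trans ?_
  have h1 := hb x (η + eZ j)
  have h2 := hb x η
  have h3 := peetre (cz η) (cz (η + eZ j)) s L hL
  have h5 : W (cz η - cz (η + eZ j)) ≤ 1 + n * 1 ^ 2 := by
    apply W_le_of_norm
    rw [cz_add, cz_eZ, sub_add_cancel_left, norm_neg]
    exact norm_eR_le j
  have p3 := W_pos (cz η - cz (η + eZ j))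
  have p4 := Real.rpow_pos_of_pos (W_pos (cz η)) s
  have h6 : W (cz (η + eZ j)) ^ s ≤ 2 ^ L * W (cz η) ^ s * (1 + n * 1 ^ 2) ^ L :=
    h3.trans (by gcongr)
  have h7 : C * W (cz (η + eZ j)) ^ s ≤ C * (2 ^ L * W (cz η) ^ s * (1 + n * 1 ^ 2) ^ L) := by
    gcongr
  linarith

/-- First-variable coordinate functional. -/
noncomputable def l1 {n : ℕ} (j : Fin n) : ((Fin n → ℝ) × (Fin n → ℝ)) →L[ℝ] ℝ :=
  (pj j).comp (ContinuousLinearMap.fst ℝ _ _)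
/-- Second-variable coordinate functional. -/
noncomputable def l2 {n : ℕ} (j : Fin n) : ((Fin n → ℝ) × (Fin n → ℝ)) →L[ℝ] ℝ :=
  (pj j).comp (ContinuousLinearMap.snd ℝ _ _)

lemma fderiv_eq_sum {n : ℕ} (f : (Fin n → ℝ) → ℂ) (x : Fin n → ℝ) :
    fderiv ℝ f x = ∑ j, (pj j).smulRight (dline j f x) := by
  ext v
  have hv : v = ∑ j, v j • eR j := by
    ext i
    simp [eR, Finset.sum_apply]
  conv_lhs => rw [hv]
  rw [map_sum]
  simp [pj, dline_eq]

/-- Derivative of the individual terms of the series. -/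
noncomputable def tD {n : ℕ} (κ : Fin n → ℕ) (b : (Fin n → ℝ) → (Fin n → ℤ) → ℂ)
    (η : Fin n → ℤ) (p : (Fin n → ℝ) × (Fin n → ℝ)) : ((Fin n → ℝ) × (Fin n → ℝ)) →L[ℝ] ℂ :=
  ∑ j, ((l1 j).smulRight (K κ (p.2 - cz η) * dX j b p.1 η) +
    (l2 j).smulRight (K (κ + eN j) (p.2 + eR j - cz η) * b p.1 η -
      K (κ + eN j) (p.2 - cz η) * b p.1 η))

lemma term_hasFDerivAt {n : ℕ} (κ : Fin n → ℕ) (b : (Fin n → ℝ) → (Fin n → ℤ) → ℂ) (hb : SmX b)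
    (η : Fin n → ℤ) (p : (Fin n → ℝ) × (Fin n → ℝ)) :
    HasFDerivAt (fun p : (Fin n → ℝ) × (Fin n → ℝ) => K κ (p.2 - cz η) * b p.1 η)
      (tD κ b η p) p := by
  have h1 : HasFDerivAt (fun p : (Fin n → ℝ) × (Fin n → ℝ) => p.2 - cz η)
      (ContinuousLinearMap.snd ℝ _ _) p := hasFDerivAt_snd.sub_const _
  have h2 := HasFDerivAt.comp (g := K κ) p (K_hasFDerivAt κ (p.2 - cz η)) h1
  have h3 := (Smooth.diff (hb η) p.1).hasFDerivAt
  rw [fderiv_eq_sum] at h3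
  have h4 := HasFDerivAt.comp (g := fun x => b x η) p h3 hasFDerivAt_fst
  have h5 := h2.mul h4
  refine HasFDerivAt.congr_fderiv h5 ?_
  refine ContinuousLinearMap.ext fun v => ?_
  simp only [tD, l1, l2, ContinuousLinearMap.add_apply, ContinuousLinearMap.smul_apply,
    ContinuousLinearMap.comp_apply, ContinuousLinearMap.sum_apply,
    ContinuousLinearMap.smulRight_apply, Function.comp, Finset.smul_sum, smul_eq_mul,
    ContinuousLinearMap.coe_fst', ContinuousLinearMap.coe_snd']
  rw [Finset.mul_sum, Finset.mul_sum, ← Finset.sum_add_distrib]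
  apply Finset.sum_congr rfl
  intro j _
  simp only [Complex.real_smul, dX]
  rw [sub_add_eq_add_sub]
  ring

lemma hasSum_F {n : ℕ} (κ : Fin n → ℕ) (b : (Fin n → ℝ) → (Fin n → ℤ) → ℂ) (hb : Adm b)
    (x ξ : Fin n → ℝ) : HasSum (fun η => K κ (ξ - cz η) * b x η) (F κ b x ξ) := by
  obtain ⟨C, s, hC, h⟩ := hb.bound
  obtain ⟨u, hu, h2⟩ := local_bound κ b C s hC h ξ
  exact (Summable.of_norm_bounded hu (h2 x ξ (by simp))).hasSum

lemma hasSum_F_diff {n : ℕ} (κ : Fin n → ℕ) (b : (Fin n → ℝ) → (Fin n → ℤ) → ℂ) (hb : Adm b)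
    (j : Fin n) (x ξ : Fin n → ℝ) :
    HasSum (fun η => K κ (ξ + eR j - cz η) * b x η - K κ (ξ - cz η) * b x η)
      (F κ (dN j b) x ξ) := by
  have h1 := hasSum_F κ b hb x (ξ + eR j)
  have h2 := hasSum_F κ b hb x ξ
  have h3 := h1.sub h2
  have h4 := (Equiv.addRight (eZ j)).hasSum_iff.2 h1
  have h5 := h4.sub h2
  have h6 : HasSum (fun η => K κ (ξ - cz η) * dN j b x η)
      (F κ b x (ξ + eR j) - F κ b x ξ) := by
    refine h5.congr_fun ?_
    intro η
    simp only [Function.comp, Equiv.coe_addRight, dN, fdiff]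
    rw [cz_add, cz_eZ, add_sub_add_right_eq_sub]
    exact mul_sub (K κ (ξ - cz η)) (b x (η + eZ j)) (b x η)
  rw [h6.unique (hasSum_F κ _ (hb.dN j b) x ξ)] at h3
  exact h3

lemma F_hasFDerivAt {n : ℕ} (κ : Fin n → ℕ) (b : (Fin n → ℝ) → (Fin n → ℤ) → ℂ) (hb : Adm b)
    (p : (Fin n → ℝ) × (Fin n → ℝ)) :
    HasFDerivAt (fun p : (Fin n → ℝ) × (Fin n → ℝ) => F κ b p.1 p.2)
      (∑ j, ((l1 j).smulRight (F κ (dX j b) p.1 p.2) +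
        (l2 j).smulRight (F (κ + eN j) (dN j b) p.1 p.2))) p := by
  have B1 : ∀ j : Fin n, ∃ u : (Fin n → ℤ) → ℝ, Summable u ∧ ∀ x ξ, ‖ξ - p.2‖ ≤ 1 →
      ∀ η, ‖K κ (ξ - cz η) * dX j b x η‖ ≤ u η := by
    intro j
    obtain ⟨C, s, hC, h⟩ := (hb.dX j b).bound
    exact local_bound κ _ C s hC h p.2
  obtain ⟨C, s, hC, h⟩ := hb.bound
  choose u1 hu1 hb1 using B1
  choose u2 hu2 hb2 using fun j : Fin n => local_bound (κ + eN j) b C s hC h (p.2 + eR j)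
  choose u3 hu3 hb3 using fun j : Fin n => local_bound (κ + eN j) b C s hC h p.2
  have hsum : Summable fun η => ∑ j : Fin n, (‖l1 j‖ * u1 j η + ‖l2 j‖ * (u2 j η + u3 j η)) := by
    apply summable_sum
    intro j _
    exact ((hu1 j).mul_left _).add (((hu2 j).add (hu3 j)).mul_left _)
  have key := hasFDerivAt_tsum_of_isPreconnected (𝕜 := ℝ)
    (f := fun η (p : (Fin n → ℝ) × (Fin n → ℝ)) => K κ (p.2 - cz η) * b p.1 η)
    (f' := fun η p => tD κ b η p)
    hsum (Metric.isOpen_ball (x := p) (ε := 1)) (convex_ball p 1).isPreconnected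
    (fun η q _ => term_hasFDerivAt κ b hb.1 η q)
    (by
      intro η q hq
      have hq2 : ‖q.2 - p.2‖ ≤ 1 := by
        rw [mem_ball_iff_norm] at hq
        exact (norm_snd_le (q - p)).trans hq.le
      unfold tD
      refine norm_sum_le_of_le _ fun j _ => ?_
      refine norm_add_le_of_le ?_ ?_
      · rw [ContinuousLinearMap.norm_smulRight_apply]
        gcongr
        exact hb1 j _ _ hq2 η
      · rw [ContinuousLinearMap.norm_smulRight_apply]
        gcongr
        refine norm_sub_le_of_le ?_ ?_
        · exact hb2 j _ _ (by rwa [add_sub_add_right_eq_sub]) η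
        · exact hb3 j _ _ hq2 η)
    (Metric.mem_ball_self one_pos) (hasSum_F κ b hb p.1 p.2).summable
    (Metric.mem_ball_self one_pos)
  refine HasFDerivAt.congr_fderiv key ?_
  apply HasSum.tsum_eq
  unfold tD
  apply hasSum_sum
  intro j _
  have m1 := (hasSum_F κ _ (hb.dX j b) p.1 p.2).mapL (ContinuousLinearMap.smulRightL ℝ _ ℂ (l1 j))
  have m2 := (hasSum_F_diff (κ + eN j) _ hb j p.1 p.2).mapL
    (ContinuousLinearMap.smulRightL ℝ _ ℂ (l2 j))
  exact m1.add m2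

lemma F_contDiff {n : ℕ} (k : ℕ) : ∀ (κ : Fin n → ℕ) (b : (Fin n → ℝ) → (Fin n → ℤ) → ℂ), Adm b →
    ContDiff ℝ k (fun p : (Fin n → ℝ) × (Fin n → ℝ) => F κ b p.1 p.2) := by
  induction k with
  | zero =>
    intro κ b hb
    rw [Nat.cast_zero, contDiff_zero]
    exact continuous_iff_continuousAt.2 fun p => (F_hasFDerivAt κ b hb p).continuousAt
  | succ k ih =>
    intro κ b hb
    rw [Nat.cast_succ, contDiff_succ_iff_fderiv]
    refine ⟨fun p => (F_hasFDerivAt κ b hb p).differentiableAt, by simp, ?_⟩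
    have : fderiv ℝ (fun p : (Fin n → ℝ) × (Fin n → ℝ) => F κ b p.1 p.2) =
      fun p => ∑ j, ((l1 j).smulRight (F κ (dX j b) p.1 p.2) +
        (l2 j).smulRight (F (κ + eN j) (dN j b) p.1 p.2)) := by
      ext1 p
      exact (F_hasFDerivAt κ b hb p).fderiv
    rw [this]
    apply ContDiff.sum
    intro j _
    exact (contDiff_const.smulRight (ih κ _ (hb.dX j b))).add
      (contDiff_const.smulRight (ih _ _ (hb.dN j b)))

lemma F_SmJ {n : ℕ} (κ : Fin n → ℕ) (b : (Fin n → ℝ) → (Fin n → ℤ) → ℂ) (hb : Adm b) :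
    SmJ (F κ b) := contDiff_infty.2 fun k => F_contDiff k κ b hb

lemma dX_F {n : ℕ} (j : Fin n) (κ : Fin n → ℕ) (b : (Fin n → ℝ) → (Fin n → ℤ) → ℂ) (hb : Adm b) :
    dX j (F κ b) = F κ (dX j b) := by
  ext x ξ
  have h := dX_joint j _ (F_SmJ κ b hb) (x, ξ)
  rw [(F_hasFDerivAt κ b hb (x, ξ)).fderiv] at h
  rw [h]
  simp [l1, l2, pj, eR]

lemma dXi_F {n : ℕ} (j : Fin n) (κ : Fin n → ℕ) (b : (Fin n → ℝ) → (Fin n → ℤ) → ℂ) (hb : Adm b) :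
    dXi j (F κ b) = F (κ + eN j) (dN j b) := by
  ext x ξ
  have h := dXi_joint j _ (F_SmJ κ b hb) (x, ξ)
  rw [(F_hasFDerivAt κ b hb (x, ξ)).fderiv] at h
  rw [h]
  simp [l1, l2, pj, eR]

lemma mderiv_F {n : ℕ} (α β : Fin n → ℕ) (b : (Fin n → ℝ) → (Fin n → ℤ) → ℂ) (hb : Adm b) :
    ∃ κ : Fin n → ℕ, ∀ x ξ, mderiv β (fun y => mderiv α (fun η => F 0 b y η) ξ) x =
      F κ (fun x η => mdiff α (fun ζ => mderiv β (fun y => b y ζ) x) η) x ξ := by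
  obtain ⟨hb1, κ, h1⟩ := opf_rel
    (fun (f : (Fin n → ℝ) → (Fin n → ℝ) → ℂ) g => Adm g ∧ ∃ κ, f = F κ g) dXi dN
    (by
      rintro j f g ⟨hg, κ, rfl⟩
      exact ⟨hg.dN j g, _, dXi_F j κ g hg⟩) α (List.finRange n) (F 0 b) b ⟨hb, 0, rfl⟩
  have h2 := opf_rel
    (fun (f : (Fin n → ℝ) → (Fin n → ℝ) → ℂ) g => Adm g ∧ f = F κ g) dX dX
    (by
      rintro j f g ⟨hg, rfl⟩
      exact ⟨hg.dX j g, dX_F j κ g hg⟩) β (List.finRange n) _ _ ⟨hb1, h1⟩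
  refine ⟨κ, fun x ξ => ?_⟩
  have h3 := congrFun (congrFun h2.2 x) ξ
  rw [opf_dX] at h3
  have e1 : (fun y => opf dXi α (List.finRange n) (F 0 b) y ξ) =
    fun y => mderiv α (fun η => F 0 b y η) ξ := by
    ext y; rw [opf_dXi]; rfl
  have e2 : opf dX β (List.finRange n) (opf dN α (List.finRange n) b) =
    fun x η => mdiff α (fun ζ => mderiv β (fun y => b y ζ) x) η := by
    ext x η
    rw [opf_dX, ← mderiv_mdiff α β b hb.1, mderiv_eq]
    have e3 : (fun y => opf dN α (List.finRange n) b y η) =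
        fun y => mdiff α (fun ζ => b y ζ) η := by
      ext y; rw [opf_dN]; rfl
    rw [e3]
  rw [e1, e2] at h3
  exact h3

lemma F_int {n : ℕ} (b : (Fin n → ℝ) → (Fin n → ℤ) → ℂ) (x : Fin n → ℝ) (ξ : Fin n → ℤ) :
    F 0 b x (cz ξ) = b x ξ := by
  have e : ∀ η, cz ξ - cz η = cz (ξ - η) := by intro η; ext i; simp [cz]
  unfold F
  rw [tsum_eq_single ξ]
  · rw [e, K_int]; simp
  · intro η hη
    rw [e, K_int, if_neg (sub_ne_zero.2 hη.symm), zero_mul]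

end TS
/-- A function `a(x,ξ)`, smooth and `1`-periodic in `x` for each `ξ ∈ ℤⁿ`, is a toroidal symbol
in `S^m_{ρ,δ}(𝕋ⁿ × ℤⁿ)` if and only if it is the restriction to `𝕋ⁿ × ℤⁿ` of a Euclidean
symbol `a' ∈ S^m_{ρ,δ}(𝕋ⁿ × ℝⁿ)`. -/
theorem toroidal_symbol_iff_restriction_of_euclidean_symbol
    (n : ℕ) (hn : 1 ≤ n) (m ρ δ : ℝ)
    (hδ0 : 0 ≤ δ) (hδ1 : δ ≤ 1) (hρ0 : 0 < ρ) (hρ1 : ρ ≤ 1)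
    (a : (Fin n → ℝ) → (Fin n → ℤ) → ℂ)
    (hsmooth : ∀ ξ : Fin n → ℤ, ContDiff ℝ (⊤ : ℕ∞) fun x => a x ξ)
    (hper : ∀ (x : Fin n → ℝ) (ξ k : Fin n → ℤ), a (x + fun i => (k i : ℝ)) ξ = a x ξ) :
    ToroidalSymbolClass n m ρ δ a ↔
      ∃ a' : (Fin n → ℝ) → (Fin n → ℝ) → ℂ,
        EuclideanSymbolClass n m ρ δ a' ∧
          ∀ (x : Fin n → ℝ) (ξ : Fin n → ℤ), a' x (fun i => (ξ i : ℝ)) = a x ξ := by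
  constructor
  · intro h
    have hA : TS.Adm a := by
      refine ⟨hsmooth, fun β => ?_⟩
      obtain ⟨C, hC, hb⟩ := h 0 β
      refine ⟨C, (m - ρ * ∑ i, (((0 : Fin n → ℕ) i : ℕ) : ℝ) + δ * ∑ i, (β i : ℝ)) / 2, hC, fun x η => ?_⟩
      have := hb x η
      rw [TS.mdiff_eq, TS.opf_zero] at this
      exact this
    refine ⟨TS.F 0 a, ⟨TS.F_SmJ 0 a hA, ?_, ?_⟩, fun x ξ => TS.F_int a x ξ⟩
    · intro x ξ k
      unfold TS.F
      simp_rw [hper]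
    · intro α β
      obtain ⟨C, hC, hb⟩ := h α β
      obtain ⟨κ, hκ⟩ := TS.mderiv_F α β a hA
      obtain ⟨D, hD, hF⟩ := TS.F_bound κ
        (fun x η => mdiff α (fun ζ => mderiv β (fun y => a y ζ) x) η) C _ hC hb
      refine ⟨D, hD, fun x ξ => ?_⟩
      rw [hκ]
      exact hF x ξ
  · rintro ⟨a', ⟨hs, -, hest⟩, hres⟩ α β
    obtain ⟨C, hC, hb⟩ := hest α β
    obtain ⟨r, hr⟩ := TS.mdiff_bound α
    set s := (m - ρ * ∑ i, (α i : ℝ) + δ * ∑ i, (β i : ℝ)) / 2 with hsdef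
    obtain ⟨L, hL⟩ := exists_nat_ge |s|
    refine ⟨C * (2 ^ L * (1 + n * r ^ 2) ^ L), by positivity, fun x ξ => ?_⟩
    have e : (fun η => mderiv β (fun y => a y η) x) =
        fun η => (fun ζ => mderiv β (fun y => a' y ζ) x) (TS.cz η) := by
      ext η
      have : (fun y => a y η) = fun y => a' y (TS.cz η) := by
        ext y
        exact (hres y η).symm
      rw [this]
    rw [e]
    refine hr _ (TS.smooth_mderiv_left β a' hs x) ξ _ fun ζ hζ => ?_
    rw [← TS.mderiv_mderiv α β a' hs]
    refine (hb x ζ).trans ?_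
    change C * TS.W ζ ^ s ≤ C * (2 ^ L * (1 + n * r ^ 2) ^ L) * TS.W (TS.cz ξ) ^ s
    have h1 := TS.peetre (TS.cz ξ) ζ s L hL
    have h2 := TS.W_le_of_norm (TS.cz ξ - ζ) r (by rwa [norm_sub_rev])
    have p1 := TS.W_pos (TS.cz ξ - ζ)
    have p2 := Real.rpow_pos_of_pos (TS.W_pos (TS.cz ξ)) s
    calc C * TS.W ζ ^ s
        ≤ C * (2 ^ L * TS.W (TS.cz ξ) ^ s * TS.W (TS.cz ξ - ζ) ^ L) := by gcongr
      _ ≤ C * (2 ^ L * TS.W (TS.cz ξ) ^ s * (1 + n * r ^ 2) ^ L) := by gcongr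
      _ = _ := by ring
end

section
/- Let n ≥ 1, m ∈ ℝ, and let σ : ℤⁿ × ℝⁿ → ℂ be such that for each k ∈ ℤⁿ the function x ↦ σ(k, x) is smooth and 1-periodic, and for every multi-index β ∈ ℕⁿ there exists a constant C_β > 0 with |∂_x^β σ(k, x)| ≤ C_β (1 + |k|²)^{m/2} for all k ∈ ℤⁿ and x ∈ ℝⁿ. If f : ℤⁿ → ℂ is rapidly decreasing, i.e., for every M ∈ ℝ there exists C_M > 0 with |f(j)| ≤ C_M (1 + |j|²)^{−M/2} for all j ∈ ℤⁿ, then the function t_σ f : ℤⁿ → ℂ defined by (t_σ f)(k) := ∫_{[0,1]ⁿ} e^{2πi k·ξ} σ(k, ξ) (Σ_{j ∈ ℤⁿ} f(j) e^{−2πi j·ξ}) dξ is also rapidly decreasing: for every M ∈ ℝ there exists C'_M > 0 with |(t_σ f)(k)| ≤ C'_M (1 + |k|²)^{−M/2} for all k ∈ ℤⁿ. In other words, the discrete pseudo-differential operator t_σ maps the discrete Schwartz space 𝒮(ℤⁿ) into itself. -/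
open scoped BigOperators
open MeasureTheory

/-- The character `x ↦ e^{2πi k·x}` on `ℝⁿ`, `k ∈ ℤⁿ`. -/
noncomputable def eK {n : ℕ} (k : Fin n → ℤ) (x : Fin n → ℝ) : ℂ :=
  Complex.exp (2 * (Real.pi : ℂ) * Complex.I * ((∑ i, (k i : ℝ) * x i : ℝ) : ℂ))

/-- The Fourier transform on `ℤⁿ` of a rapidly decreasing function `f : ℤⁿ → ℂ`:
`(𝓕 f)(ξ) = Σ_j f(j) e^{-2πi j·ξ}`. -/
noncomputable def uFS {n : ℕ} (f : (Fin n → ℤ) → ℂ) (x : Fin n → ℝ) : ℂ :=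
  ∑' j : Fin n → ℤ, f j * eK (-j) x

/-- The discrete pseudo-differential operator with symbol `σ : ℤⁿ × 𝕋ⁿ → ℂ`:
`(t_σ f)(k) = ∫_{[0,1]ⁿ} e^{2πi k·ξ} σ(k,ξ) (𝓕 f)(ξ) dξ`. -/
noncomputable def discretePDOS {n : ℕ} (σ : (Fin n → ℤ) → (Fin n → ℝ) → ℂ)
    (f : (Fin n → ℤ) → ℂ) (k : Fin n → ℤ) : ℂ :=
  ∫ ξ in Set.Icc (0 : Fin n → ℝ) 1, eK k ξ * σ k ξ * uFS f ξ

theorem aux_dline_smooth {n : ℕ} (j : Fin n) {g : (Fin n → ℝ) → ℂ}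
    (hg : ContDiff ℝ (⊤ : ℕ∞) g) : ContDiff ℝ (⊤ : ℕ∞) (dline j g) := by
  unfold dline
  have h : ContDiff ℝ (⊤ : ℕ∞) (fderiv ℝ g) := hg.fderiv_right (by simp)
  exact h.clm_apply contDiff_const

theorem aux_dline_per {n : ℕ} (j : Fin n) {g : (Fin n → ℝ) → ℂ}
    (hg : ∀ (x : Fin n → ℝ) (l : Fin n → ℤ), g (x + fun i => (l i : ℝ)) = g x) :
    ∀ (x : Fin n → ℝ) (l : Fin n → ℤ), dline j g (x + fun i => (l i : ℝ)) = dline j g x := by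
  intro x l
  unfold dline
  rw [← fderiv_comp_add_right (fun i => (l i : ℝ))]
  simp only [hg]

theorem aux_mderiv_single {n : ℕ} (i : Fin n) (N : ℕ) (g : (Fin n → ℝ) → ℂ) :
    mderiv (Pi.single i N) g = (dline i)^[N] g := by
  unfold mderiv
  have key : ∀ L : List (Fin n), L.Nodup →
      L.foldr (fun j g => (dline j)^[(Pi.single i N : Fin n → ℕ) j] g) g
        = if i ∈ L then (dline i)^[N] g else g := by
    intro L
    induction L with
    | nil => simp
    | cons a L ih =>
      intro h
      rw [List.nodup_cons] at h
      rw [List.foldr_cons, ih h.2]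
      by_cases hia : i = a
      · subst hia
        simp [h.1]
      · have : (Pi.single i N : Fin n → ℕ) a = 0 := by
          simp [Ne.symm hia]
        simp [hia]
  rw [key _ (List.nodup_finRange n)]
  simp

theorem aux_eK_smooth {n : ℕ} (l : Fin n → ℤ) : ContDiff ℝ (⊤ : ℕ∞) (eK l) := by
  unfold eK
  apply ContDiff.cexp
  apply ContDiff.mul contDiff_const
  have h : ContDiff ℝ (⊤ : ℕ∞) (fun x : Fin n → ℝ => ∑ i, (l i : ℝ) * x i) := by
    apply ContDiff.sum
    intro i _
    exact contDiff_const.mul (contDiff_apply ℝ ℝ i)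
  exact Complex.ofRealCLM.contDiff.comp h

theorem aux_eK_norm {n : ℕ} (l : Fin n → ℤ) (x : Fin n → ℝ) : ‖eK l x‖ = 1 := by
  unfold eK
  have : 2 * (Real.pi : ℂ) * Complex.I * ((∑ i, (l i : ℝ) * x i : ℝ) : ℂ)
    = ((2 * Real.pi * (∑ i, (l i : ℝ) * x i) : ℝ) : ℂ) * Complex.I := by
    push_cast; ring
  rw [this, Complex.norm_exp_ofReal_mul_I]

theorem aux_eK_add {n : ℕ} (k l : Fin n → ℤ) (x : Fin n → ℝ) :
    eK (k + l) x = eK k x * eK l x := by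
  unfold eK
  rw [← Complex.exp_add]
  congr 1
  simp only [Pi.add_apply, Int.cast_add, add_mul, Finset.sum_add_distrib]
  push_cast
  ring

theorem aux_eK_per {n : ℕ} (k : Fin n → ℤ) (x : Fin n → ℝ) (l : Fin n → ℤ) :
    eK k (x + fun i => (l i : ℝ)) = eK k x := by
  unfold eK
  rw [Complex.exp_eq_exp_iff_exists_int]
  refine ⟨∑ i, k i * l i, ?_⟩
  simp only [Pi.add_apply, mul_add, Finset.sum_add_distrib]
  push_cast
  ring

theorem aux_eK_dline {n : ℕ} (l : Fin n → ℤ) (j : Fin n) (x : Fin n → ℝ) :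
    dline j (eK l) x = (2 * Real.pi * Complex.I * (l j : ℂ)) * eK l x := by
  unfold dline
  have h1 : HasFDerivAt (fun y : Fin n → ℝ => ∑ i, (l i : ℝ) * y i)
      (∑ i, (l i : ℝ) • (ContinuousLinearMap.proj i : (Fin n → ℝ) →L[ℝ] ℝ)) x := by
    apply HasFDerivAt.fun_sum
    intro i _
    exact (hasFDerivAt_apply i x).const_mul _
  have h2 := ((Complex.ofRealCLM.hasFDerivAt.comp x h1).const_mul
    (2 * (Real.pi : ℂ) * Complex.I)).cexp
  have h3 : fderiv ℝ (eK l) x = _ := h2.fderiv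
  rw [h3]
  simp [eK]
  ring

/-- The integral of a partial derivative of a periodic function vanishes. -/
theorem aux_int_dline {n : ℕ} (j : Fin n) {g : (Fin n → ℝ) → ℂ}
    (hg : ContDiff ℝ (⊤ : ℕ∞) g)
    (hper : ∀ (x : Fin n → ℝ) (l : Fin n → ℤ), g (x + fun i => (l i : ℝ)) = g x) :
    ∫ x in Set.Icc (0 : Fin n → ℝ) 1, dline j g x = 0 := by
  obtain _ | n := n
  · exact j.elim0
  have hd : Differentiable ℝ g := hg.differentiable (by simp)
  have hsum : ∀ x, ∑ i, (if i = j then fderiv ℝ g x else 0) (Pi.single i (1 : ℝ))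
      = dline j g x := by
    intro x
    rw [Finset.sum_eq_single j]
    · simp only [if_true, dline]
      congr 1
      ext i
      simp [Pi.single_apply]
    · intro b _ hb
      simp [hb]
    · simp
  have := integral_divergence_of_hasFDerivAt_off_countable' (0 : Fin (n+1) → ℝ) 1
    zero_le_one (fun i x => if i = j then g x else 0)
    (fun i x => if i = j then fderiv ℝ g x else 0) ∅ Set.countable_empty
    (by
      intro i
      by_cases h : i = j
      · simpa [h] using hg.continuous.continuousOn
      · simpa [h] using continuousOn_const)
    (by
      intro x _ i
      by_cases h : i = j
      · simpa [h] using (hd x).hasFDerivAt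
      · simpa [h] using hasFDerivAt_const (0 : ℂ) x)
    (by
      simp only [hsum]
      exact (aux_dline_smooth j hg).continuous.continuousOn.integrableOn_compact isCompact_Icc)
  simp only [hsum] at this
  rw [this]
  apply Finset.sum_eq_zero
  intro i _
  rw [sub_eq_zero]
  congr 1
  ext y
  by_cases h : i = j
  · subst h
    simp only [if_true]
    rw [← hper (i.insertNth ((0 : Fin (n + 1) → ℝ) i) y) (Pi.single i 1)]
    congr 1
    ext a
    refine Fin.succAboveCases i ?_ ?_ a
    · simp
    · intro b
      simp [Pi.single_apply, Fin.succAbove_ne]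
  · simp [h]

theorem aux_ibp {n : ℕ} (j : Fin n) (l : Fin n → ℤ) {g : (Fin n → ℝ) → ℂ}
    (hg : ContDiff ℝ (⊤ : ℕ∞) g)
    (hper : ∀ (x : Fin n → ℝ) (l : Fin n → ℤ), g (x + fun i => (l i : ℝ)) = g x) :
    ∫ x in Set.Icc (0 : Fin n → ℝ) 1, eK l x * dline j g x
      = - (2 * Real.pi * Complex.I * (l j : ℂ)) *
        ∫ x in Set.Icc (0 : Fin n → ℝ) 1, eK l x * g x := by
  have h := aux_int_dline j ((aux_eK_smooth l).mul hg) (by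
    intro x k
    rw [hper, aux_eK_per])
  have hd : Differentiable ℝ g := hg.differentiable (by simp)
  have he : Differentiable ℝ (eK l) := (aux_eK_smooth l).differentiable (by simp)
  have hp : ∀ x, dline j (eK l * g) x = eK l x * dline j g x
      + (2 * Real.pi * Complex.I * (l j : ℂ)) * (eK l x * g x) := by
    intro x
    have h1 := aux_eK_dline l j x
    unfold dline at h1 ⊢
    rw [fderiv_mul (he x) (hd x)]
    simp only [add_apply, smul_apply, smul_eq_mul]
    rw [h1]
    ring
  have hc1 : Continuous (fun x => eK l x * dline j g x) :=
    (aux_eK_smooth l).continuous.mul (aux_dline_smooth j hg).continuous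
  have hc2 : Continuous (fun x => (2 * Real.pi * Complex.I * (l j : ℂ)) * (eK l x * g x)) :=
    continuous_const.mul ((aux_eK_smooth l).continuous.mul hg.continuous)
  simp only [Pi.mul_def] at hp h
  simp only [hp] at h
  rw [integral_add (hc1.continuousOn.integrableOn_compact isCompact_Icc)
    (hc2.continuousOn.integrableOn_compact isCompact_Icc),
    integral_const_mul] at h
  rw [eq_neg_of_add_eq_zero_left h, neg_mul]

theorem aux_iter {n : ℕ} (j : Fin n) (l : Fin n → ℤ) (N : ℕ) : ∀ {g : (Fin n → ℝ) → ℂ}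
    (_ : ContDiff ℝ (⊤ : ℕ∞) g)
    (_ : ∀ (x : Fin n → ℝ) (l : Fin n → ℤ), g (x + fun i => (l i : ℝ)) = g x),
    ∫ x in Set.Icc (0 : Fin n → ℝ) 1, eK l x * (dline j)^[N] g x
      = (- (2 * Real.pi * Complex.I * (l j : ℂ))) ^ N *
        ∫ x in Set.Icc (0 : Fin n → ℝ) 1, eK l x * g x := by
  induction N with
  | zero => intro g _ _; simp
  | succ N ih =>
    intro g hg hper
    rw [Function.iterate_succ_apply, ih (aux_dline_smooth j hg) (aux_dline_per j hper),
      aux_ibp j l hg hper]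
    ring

theorem aux_cube_norm {n : ℕ} (l : Fin n → ℤ) {g : (Fin n → ℝ) → ℂ} {B : ℝ}
    (hB : ∀ x, ‖g x‖ ≤ B) :
    ‖∫ x in Set.Icc (0 : Fin n → ℝ) 1, eK l x * g x‖ ≤ B := by
  have h := norm_setIntegral_le_of_norm_le_const (μ := volume)
    (s := Set.Icc (0 : Fin n → ℝ) 1) (f := fun x => eK l x * g x) (C := B)
    isCompact_Icc.measure_lt_top (by
      intro x _
      rw [norm_mul, aux_eK_norm, one_mul]
      exact hB x)
  have hv : (volume : Measure (Fin n → ℝ)).real (Set.Icc 0 1) = 1 := by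
    simp [Measure.real, Real.volume_Icc_pi]
  rwa [hv, mul_one] at h

theorem aux_iter_norm {n : ℕ} (j : Fin n) (l : Fin n → ℤ) (N : ℕ) {g : (Fin n → ℝ) → ℂ}
    (hg : ContDiff ℝ (⊤ : ℕ∞) g)
    (hper : ∀ (x : Fin n → ℝ) (l : Fin n → ℤ), g (x + fun i => (l i : ℝ)) = g x)
    {B : ℝ} (hB : ∀ x, ‖mderiv (Pi.single j N) g x‖ ≤ B) :
    |(l j : ℝ)| ^ N * ‖∫ x in Set.Icc (0 : Fin n → ℝ) 1, eK l x * g x‖ ≤ B := by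
  rw [aux_mderiv_single] at hB
  have h := aux_cube_norm l hB
  rw [aux_iter j l N hg hper, norm_mul, norm_pow, norm_neg] at h
  refine le_trans ?_ h
  gcongr
  have : ‖2 * (Real.pi : ℂ) * Complex.I * (l j : ℂ)‖ = 2 * Real.pi * |(l j : ℝ)| := by
    simp [abs_of_pos Real.pi_pos]
  rw [this]
  nlinarith [Real.pi_gt_three, abs_nonneg (l j : ℝ)]

theorem aux_pow_sum {n : ℕ} (N : ℕ) (a : Fin n → ℝ) (ha : ∀ i, 0 ≤ a i) :
    (1 + ∑ i, a i) ^ (N + 1) ≤ ((n : ℝ) + 1) ^ N * (1 + ∑ i, a i ^ (N + 1)) := by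
  have h := pow_sum_le_card_mul_sum_pow (s := (Finset.univ : Finset (Option (Fin n))))
    (f := fun o => o.elim 1 a) (by intro i _; cases i <;> simp [ha]) N
  simpa [Fintype.sum_option] using h

/-- Decay of the Fourier coefficients of the symbol. -/
theorem aux_decay {n : ℕ} (N : ℕ) (m : ℝ)
    (σ : (Fin n → ℤ) → (Fin n → ℝ) → ℂ)
    (hsmooth : ∀ k : Fin n → ℤ, ContDiff ℝ (⊤ : ℕ∞) (σ k))
    (hper : ∀ (k : Fin n → ℤ) (x : Fin n → ℝ) (j : Fin n → ℤ),
      σ k (x + fun i => (j i : ℝ)) = σ k x)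
    (hsym : ∀ β : Fin n → ℕ, ∃ C : ℝ, 0 < C ∧ ∀ (k : Fin n → ℤ) (x : Fin n → ℝ),
      ‖mderiv β (σ k) x‖ ≤ C * (1 + ∑ i, (k i : ℝ) ^ 2) ^ (m / 2)) :
    ∃ C : ℝ, 0 < C ∧ ∀ k l : Fin n → ℤ,
      (1 + ∑ i, (l i : ℝ) ^ 2) ^ (N + 1) *
        ‖∫ x in Set.Icc (0 : Fin n → ℝ) 1, eK l x * σ k x‖
        ≤ C * (1 + ∑ i, (k i : ℝ) ^ 2) ^ (m / 2) := by
  obtain ⟨C0, hC0, h0⟩ := hsym 0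
  choose Ci hCi hi using fun i : Fin n => hsym (Pi.single i (2 * (N + 1)))
  have hS : 0 ≤ ∑ i, Ci i := Finset.sum_nonneg fun i _ => (hCi i).le
  refine ⟨((n : ℝ) + 1) ^ N * (C0 + ∑ i, Ci i), by positivity, fun k l => ?_⟩
  set A := (1 + ∑ i, (k i : ℝ) ^ 2) ^ (m / 2)
  set I := ‖∫ x in Set.Icc (0 : Fin n → ℝ) 1, eK l x * σ k x‖
  have hI : 0 ≤ I := norm_nonneg _
  have e0 : I ≤ C0 * A := by
    apply aux_cube_norm
    intro x
    have := h0 k x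
    have hz : mderiv 0 (σ k) = σ k := by
      unfold mderiv
      simp
    rwa [hz] at this
  have ei : ∀ i, ((l i : ℝ) ^ 2) ^ (N + 1) * I ≤ Ci i * A := by
    intro i
    have := aux_iter_norm i l (2 * (N + 1)) (hsmooth k) (hper k) (hi i k)
    rwa [pow_mul, sq_abs] at this
  have hp := aux_pow_sum N (fun i => (l i : ℝ) ^ 2) (fun i => sq_nonneg _)
  calc _ ≤ (((n : ℝ) + 1) ^ N * (1 + ∑ i, ((l i : ℝ) ^ 2) ^ (N + 1))) * I := by gcongr
    _ = ((n : ℝ) + 1) ^ N * (I + ∑ i, ((l i : ℝ) ^ 2) ^ (N + 1) * I) := by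
      rw [← Finset.sum_mul]; ring
    _ ≤ ((n : ℝ) + 1) ^ N * (C0 * A + ∑ i, Ci i * A) := by
      gcongr ?_ * (?_ + ?_)
      exact Finset.sum_le_sum fun i _ => ei i
    _ = _ := by rw [← Finset.sum_mul]; ring

theorem aux_summable_one : Summable (fun a : ℤ => (1 + (a : ℝ) ^ 2)⁻¹) := by
  refine Summable.of_norm_bounded_eventually
    (Real.summable_one_div_int_pow.mpr (by norm_num : 1 < 2)) ?_
  filter_upwards [(Set.finite_singleton (0 : ℤ)).compl_mem_cofinite] with a ha
  have ha' : (a : ℝ) ≠ 0 := by simpa using ha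
  have : 0 < (a : ℝ) ^ 2 := by positivity
  rw [Real.norm_of_nonneg (by positivity), one_div]
  gcongr
  linarith

theorem aux_summable_prod (n : ℕ) :
    Summable (fun j : Fin n → ℤ => ∏ i, (1 + (j i : ℝ) ^ 2)⁻¹) := by
  refine summable_of_sum_le (c := (∑' a : ℤ, (1 + (a : ℝ) ^ 2)⁻¹) ^ n)
    (fun j => Finset.prod_nonneg fun i _ => by positivity) fun u => ?_
  calc _ ≤ ∑ j ∈ Fintype.piFinset (fun i : Fin n => u.image (fun j : Fin n → ℤ => j i)),
        ∏ i, (1 + (j i : ℝ) ^ 2)⁻¹ := by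
        apply Finset.sum_le_sum_of_subset_of_nonneg
        · intro j hj
          simp only [Fintype.mem_piFinset, Finset.mem_image]
          exact fun i => ⟨j, hj, rfl⟩
        · intro j _ _
          exact Finset.prod_nonneg fun i _ => by positivity
    _ = ∏ i, ∑ a ∈ u.image (fun j : Fin n → ℤ => j i), (1 + (a : ℝ) ^ 2)⁻¹ := by
        rw [Finset.prod_univ_sum]
    _ ≤ ∏ i : Fin n, ∑' a : ℤ, (1 + (a : ℝ) ^ 2)⁻¹ := by
        apply Finset.prod_le_prod
        · intro i _
          exact Finset.sum_nonneg fun a _ => by positivity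
        · intro i _
          exact aux_summable_one.sum_le_tsum _ fun a _ => by positivity
    _ = _ := by simp

theorem aux_summable_f {n : ℕ} (N : ℕ) (f : (Fin n → ℤ) → ℂ)
    (hf : ∀ M : ℝ, ∃ C : ℝ, 0 < C ∧ ∀ j : Fin n → ℤ,
      ‖f j‖ ≤ C * (1 + ∑ i, (j i : ℝ) ^ 2) ^ (-M / 2)) :
    Summable (fun j => ‖f j‖ * (1 + ∑ i, (j i : ℝ) ^ 2) ^ N) := by
  obtain ⟨C, hC, h⟩ := hf (2 * ((N + n : ℕ) : ℝ))
  refine Summable.of_nonneg_of_le (fun j => by positivity) (fun j => ?_)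
    ((aux_summable_prod n).mul_left C)
  have hw : 0 < 1 + ∑ i, (j i : ℝ) ^ 2 := by positivity
  have h1 := h j
  rw [show -(2 * ((N + n : ℕ) : ℝ)) / 2 = -((N + n : ℕ) : ℝ) by ring,
    Real.rpow_neg hw.le, Real.rpow_natCast] at h1
  calc _ ≤ C * ((1 + ∑ i, (j i : ℝ) ^ 2) ^ (N + n))⁻¹ * (1 + ∑ i, (j i : ℝ) ^ 2) ^ N := by gcongr
    _ = C * ((1 + ∑ i, (j i : ℝ) ^ 2) ^ n)⁻¹ := by
      rw [pow_add]; field_simp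
    _ ≤ _ := by
      rw [Finset.prod_inv_distrib]
      gcongr
      have hp : ∏ i : Fin n, (1 + (j i : ℝ) ^ 2) ≤ ∏ i : Fin n, (1 + ∑ i, (j i : ℝ) ^ 2) := by
        apply Finset.prod_le_prod
        · intro i _; positivity
        · intro i _
          have := Finset.single_le_sum (f := fun i => (j i : ℝ) ^ 2)
            (fun i _ => sq_nonneg _) (Finset.mem_univ i)
          simpa using this
      simpa using hp

theorem aux_peetre {n : ℕ} (k j : Fin n → ℤ) :
    (1 + ∑ i, (k i : ℝ) ^ 2) ≤
      2 * (1 + ∑ i, (j i : ℝ) ^ 2) * (1 + ∑ i, (((k + -j) i : ℤ) : ℝ) ^ 2) := by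
  have h1 : ∑ i, (k i : ℝ) ^ 2 ≤
      2 * ∑ i, (j i : ℝ) ^ 2 + 2 * ∑ i, (((k + -j) i : ℤ) : ℝ) ^ 2 := by
    rw [Finset.mul_sum, Finset.mul_sum, ← Finset.sum_add_distrib]
    apply Finset.sum_le_sum
    intro i _
    simp only [Pi.add_apply, Pi.neg_apply, Int.cast_add, Int.cast_neg]
    nlinarith [sq_nonneg ((k i : ℝ) - 2 * j i)]
  have h2 : 0 ≤ ∑ i, (j i : ℝ) ^ 2 := by positivity
  have h3 : 0 ≤ ∑ i, (((k + -j) i : ℤ) : ℝ) ^ 2 := by positivity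
  nlinarith [mul_nonneg h2 h3]

theorem aux_hasSum {n : ℕ} (g : (Fin n → ℝ) → ℂ) (hg : Continuous g)
    (f : (Fin n → ℤ) → ℂ) (hf : Summable (fun j => ‖f j‖)) {B : ℝ} (hB : ∀ x, ‖g x‖ ≤ B)
    (k : Fin n → ℤ) :
    HasSum (fun j => f j * ∫ x in Set.Icc (0 : Fin n → ℝ) 1, eK (k + -j) x * g x)
      (∫ x in Set.Icc (0 : Fin n → ℝ) 1, eK k x * g x * uFS f x) := by
  have hc : ∀ j, Continuous (fun x => f j * (eK (k + -j) x * g x)) := fun j =>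
    continuous_const.mul ((aux_eK_smooth _).continuous.mul hg)
  have hv : (volume : Measure (Fin n → ℝ)).real (Set.Icc 0 1) = 1 := by
    simp [Measure.real, Real.volume_Icc_pi]
  have h := hasSum_integral_of_summable_integral_norm
    (μ := volume.restrict (Set.Icc (0 : Fin n → ℝ) 1))
    (F := fun j x => f j * (eK (k + -j) x * g x))
    (fun j => (hc j).continuousOn.integrableOn_compact isCompact_Icc)
    (by
      refine Summable.of_nonneg_of_le (fun j => by positivity) (fun j => ?_) (hf.mul_right B)
      calc _ ≤ ∫ x in Set.Icc (0 : Fin n → ℝ) 1, ‖f j‖ * B := by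
            apply integral_mono
            · exact (hc j).norm.continuousOn.integrableOn_compact isCompact_Icc
            · exact continuousOn_const.integrableOn_compact isCompact_Icc
            · intro x
              simp only [norm_mul, aux_eK_norm, one_mul]
              gcongr
              exact hB x
        _ = _ := by
            rw [setIntegral_const, hv, one_smul])
  simp only [integral_const_mul] at h
  have hx : ∀ x, eK k x * g x * uFS f x = ∑' j, f j * (eK (k + -j) x * g x) := ?_
  · simpa only [hx] using h
  intro x
  unfold uFS
  rw [← tsum_mul_left]
  congr 1
  ext j
  rw [aux_eK_add]
  ring

/-- A discrete pseudo-differential operator whose symbol is smooth and `1`-periodic in `x` with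
bounds `|∂_x^β σ(k,x)| ≤ C_β (1+|k|²)^{m/2}` maps the discrete Schwartz space `𝒮(ℤⁿ)` of
rapidly decreasing functions on `ℤⁿ` into itself. -/
theorem discretePDO_maps_discrete_schwartz_into_itself
    (n : ℕ) (hn : 1 ≤ n) (m : ℝ)
    (σ : (Fin n → ℤ) → (Fin n → ℝ) → ℂ)
    (hsmooth : ∀ k : Fin n → ℤ, ContDiff ℝ (⊤ : ℕ∞) (σ k))
    (hper : ∀ (k : Fin n → ℤ) (x : Fin n → ℝ) (j : Fin n → ℤ),
      σ k (x + fun i => (j i : ℝ)) = σ k x)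
    (hsym : ∀ β : Fin n → ℕ, ∃ C : ℝ, 0 < C ∧ ∀ (k : Fin n → ℤ) (x : Fin n → ℝ),
      ‖mderiv β (σ k) x‖ ≤ C * (1 + ∑ i, (k i : ℝ) ^ 2) ^ (m / 2))
    (f : (Fin n → ℤ) → ℂ)
    (hf : ∀ M : ℝ, ∃ C : ℝ, 0 < C ∧ ∀ j : Fin n → ℤ,
      ‖f j‖ ≤ C * (1 + ∑ i, (j i : ℝ) ^ 2) ^ (-M / 2)) :
    ∀ M : ℝ, ∃ C : ℝ, 0 < C ∧ ∀ k : Fin n → ℤ,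
      ‖discretePDOS σ f k‖ ≤ C * (1 + ∑ i, (k i : ℝ) ^ 2) ^ (-M / 2) := by
  intro M
  obtain ⟨N, hN⟩ := exists_nat_ge (m / 2 + M / 2)
  obtain ⟨C, hC, hdec⟩ := aux_decay N m σ hsmooth hper hsym
  have hsum0 : Summable (fun j => ‖f j‖) := by simpa using aux_summable_f 0 f hf
  have hsum := aux_summable_f (N + 1) f hf
  set S := ∑' j, ‖f j‖ * (1 + ∑ i, (j i : ℝ) ^ 2) ^ (N + 1) with hS
  have hS0 : 0 ≤ S := tsum_nonneg fun j => by positivity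
  refine ⟨C * 2 ^ (N + 1) * (S + 1), by positivity, fun k => ?_⟩
  obtain ⟨C0, hC0, h0⟩ := hsym 0
  have hz : mderiv 0 (σ k) = σ k := by
    unfold mderiv
    simp
  have hs := aux_hasSum (σ k) (hsmooth k).continuous f hsum0
    (B := C0 * (1 + ∑ i, (k i : ℝ) ^ 2) ^ (m / 2))
    (fun x => by simpa [hz] using h0 k x) k
  set w := 1 + ∑ i, (k i : ℝ) ^ 2 with hw
  have hw1 : 1 ≤ w := by
    have : 0 ≤ ∑ i, (k i : ℝ) ^ 2 := by positivity
    linarith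
  have hw0 : 0 < w := by linarith
  set K := C * w ^ (m / 2) * 2 ^ (N + 1) * (w ^ (N + 1))⁻¹ with hK
  have hb : ∀ j, ‖f j * ∫ x in Set.Icc (0 : Fin n → ℝ) 1, eK (k + -j) x * σ k x‖
      ≤ (‖f j‖ * (1 + ∑ i, (j i : ℝ) ^ 2) ^ (N + 1)) * K := by
    intro j
    rw [norm_mul, mul_assoc]
    gcongr
    have h1 := hdec k (k + -j)
    have h2 := pow_le_pow_left₀ hw0.le (aux_peetre k j) (N + 1)
    rw [mul_pow, mul_pow] at h2
    rw [hK]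
    set I := ‖∫ x in Set.Icc (0 : Fin n → ℝ) 1, eK (k + -j) x * σ k x‖
    have hI : 0 ≤ I := norm_nonneg _
    set a := (1 + ∑ i, (j i : ℝ) ^ 2) ^ (N + 1)
    have ha : 0 ≤ a := by positivity
    set b := (1 + ∑ i, (((k + -j) i : ℤ) : ℝ) ^ 2) ^ (N + 1)
    rw [← mul_assoc, ← div_eq_mul_inv, le_div_iff₀ (by positivity)]
    calc I * w ^ (N + 1) ≤ I * (2 ^ (N + 1) * a * b) := by gcongr
      _ = 2 ^ (N + 1) * a * (b * I) := by ring
      _ ≤ 2 ^ (N + 1) * a * (C * w ^ (m / 2)) := by gcongr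
      _ = _ := by ring
  have hfin : ‖discretePDOS σ f k‖ ≤ S * K := by
    unfold discretePDOS
    rw [← hs.tsum_eq, hS, ← tsum_mul_right]
    exact tsum_of_norm_bounded (hsum.mul_right K).hasSum hb
  have hpow : w ^ (m / 2) * (w ^ (N + 1))⁻¹ ≤ w ^ (-M / 2) := by
    rw [← Real.rpow_natCast, ← Real.rpow_neg hw0.le, ← Real.rpow_add hw0]
    apply Real.rpow_le_rpow_of_exponent_le hw1
    push_cast
    linarith
  calc _ ≤ S * K := hfin
    _ = C * 2 ^ (N + 1) * S * (w ^ (m / 2) * (w ^ (N + 1))⁻¹) := by rw [hK]; ring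
    _ ≤ C * 2 ^ (N + 1) * (S + 1) * w ^ (-M / 2) := by
      gcongr
      linarith
end
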